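/- arXiv:2312.12673 — 2 statements merged into one kernel-verified Lean document; each statement's English description precedes it below -/
import Mathlib

section
/- Let H be a finite graph containing a subgraph with at least two edges. For all α > 0 and β > 0 there exist L > 0 and n_0 ∈ ℕ such that the following holds for all n ≥ n_0 and all p ∈ (0,1) with p ≥ L·n^{−1/m_2(H)}: if Y is any random vector taking values in {0,1}^{E(K_n)} such that E[Y_A | (Y_w)_{w∈W}] ≤ p^{|A|} almost surely for every W ⊆ E(K_n) and every A ⊆ E(K_n)∖W, then there exists a set W ⊆ E(K_n) with |W| ≤ α·binom(n,2) and E_H(W) ≤ β·N_H(K_n), where E_H(W) is the energy defined from this Y. -/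
open scoped BigOperators

attribute [local instance] Classical.propDecidable

noncomputable section

namespace LowerTails

/-- The edge set of the complete graph `K_n`: unordered pairs of distinct elements of `Fin n`. -/
abbrev Edge (n : ℕ) := {e : Sym2 (Fin n) // ¬ e.IsDiag}

/-- A graph on `[n]`, identified with its edge-indicator vector in `{0,1}^{E(K_n)}`. -/
abbrev EGraph (n : ℕ) := Edge n → Bool

/-- The probability of the configuration `G` under the product measure where edge `e`
is present independently with probability `q e`. -/
def wt {n : ℕ} (q : Edge n → ℝ) (G : EGraph n) : ℝ :=
  ∏ e : Edge n, if G e then q e else 1 - q e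

/-- Probability of the event `S` under `G(n, q)`. -/
def pr {n : ℕ} (q : Edge n → ℝ) (S : Set (EGraph n)) : ℝ :=
  ∑ G : EGraph n, if G ∈ S then wt q G else 0

/-- Conditional probability of `S` given `L` under `G(n, q)`. -/
def cpr {n : ℕ} (q : Edge n → ℝ) (L S : Set (EGraph n)) : ℝ :=
  pr q (S ∩ L) / pr q L

/-- Conditional expectation of `f` given the event `L` under `G(n, q)`. -/
def cex {n : ℕ} (q : Edge n → ℝ) (L : Set (EGraph n)) (f : EGraph n → ℝ) : ℝ :=
  (∑ G : EGraph n, if G ∈ L then wt q G * f G else 0) / pr q L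

/-- The simple graph on `Fin n` associated to an edge-indicator vector. -/
def toSG {n : ℕ} (G : EGraph n) : SimpleGraph (Fin n) :=
  SimpleGraph.fromEdgeSet {e : Sym2 (Fin n) | ∃ h : ¬e.IsDiag, G ⟨e, h⟩ = true}

/-- The number of copies of `H` in `G`, i.e. the number of subgraphs of `G` isomorphic to `H`. -/
def countCopies {k n : ℕ} (H : SimpleGraph (Fin k)) (G : SimpleGraph (Fin n)) : ℕ :=
  Set.ncard {K : G.Subgraph | Nonempty (H ≃g K.coe)}

/-- `N_H(G)` for an edge-indicator vector `G`, as a real number. -/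
def NH {k n : ℕ} (H : SimpleGraph (Fin k)) (G : EGraph n) : ℝ :=
  countCopies H (toSG G)

/-- `E[N_H(q)]`, the expected number of copies of `H` in `G(n, q)`. -/
def expNH {k : ℕ} (H : SimpleGraph (Fin k)) {n : ℕ} (q : Edge n → ℝ) : ℝ :=
  ∑ G : EGraph n, wt q G * NH H G

/-- `N_H(K_n)`, the number of copies of `H` in the complete graph `K_n`. -/
def NHKn {k : ℕ} (H : SimpleGraph (Fin k)) (n : ℕ) : ℝ :=
  countCopies H (⊤ : SimpleGraph (Fin n))

/-- The lower tail event `L_p(H, η) = {G : N_H(G) ≤ η E[N_H(p)]}`. -/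
def lowerTail {k : ℕ} (H : SimpleGraph (Fin k)) (n : ℕ) (p η : ℝ) : Set (EGraph n) :=
  {G | NH H G ≤ η * expNH H (fun _ : Edge n => p)}

/-- `h(x) = x log x - x + 1` (with `h(0) = 1` since `Real.log 0 = 0`). -/
def hfun (x : ℝ) : ℝ := x * Real.log x - x + 1

/-- The relative entropy `i_p(t)` of `Ber(t)` with respect to `Ber(p)`. -/
def ip (p t : ℝ) : ℝ := t * Real.log (t / p) + (1 - t) * Real.log ((1 - t) / (1 - p))

/-- The number of edges of `H` as a real number. -/
def eH {k : ℕ} (H : SimpleGraph (Fin k)) : ℝ := H.edgeSet.ncard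

/-- The defining equation of the threshold `η_H`, for a graph with `e` edges. -/
def etaEq (e η : ℝ) : Prop :=
  hfun (η ^ (1 / η)) =
    hfun (η ^ (1 / e)) + η ^ (1 / e) * Real.log (η ^ (1 / e)) *
      (Real.log (η ^ (1 / η)) - Real.log (η ^ (1 / e)))

/-- The 2-density `m_2(H)`. -/
def m2 {k : ℕ} (H : SimpleGraph (Fin k)) : ℝ :=
  sSup {x : ℝ | ∃ F : H.Subgraph, 2 ≤ F.edgeSet.ncard ∧
    x = ((F.edgeSet.ncard : ℝ) - 1) / ((F.verts.ncard : ℝ) - 2)}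

/-- The variational problem `Φ_p(H, η)`. -/
def PhiP {k : ℕ} (H : SimpleGraph (Fin k)) (n : ℕ) (p η : ℝ) : ℝ :=
  sInf {x : ℝ | ∃ q : Edge n → ℝ, (∀ e, q e ∈ Set.Icc (0:ℝ) 1) ∧
    expNH H q ≤ η * expNH H (fun _ : Edge n => p) ∧ x = ∑ e : Edge n, ip p (q e)}

/-- The sparse limit variational problem `Φ(H, η)`. -/
def Phi {k : ℕ} (H : SimpleGraph (Fin k)) (n : ℕ) (η : ℝ) : ℝ :=
  sInf {x : ℝ | ∃ q : Edge n → ℝ, (∀ e, q e ∈ Set.Icc (0:ℝ) 1) ∧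
    expNH H q ≤ η * NHKn H n ∧ x = ∑ e : Edge n, hfun (q e)}

/-- The cut norm of an `n × n` real matrix. -/
def cutNorm {n : ℕ} (M : Matrix (Fin n) (Fin n) ℝ) : ℝ :=
  sSup {x : ℝ | ∃ a b : Fin n → ℝ, (∀ i, a i ∈ Set.Icc (0:ℝ) 1) ∧ (∀ i, b i ∈ Set.Icc (0:ℝ) 1) ∧
    x = |∑ i : Fin n, ∑ j : Fin n, a i * M i j * b j| / (n : ℝ) ^ 2}

/-- The symmetric matrix with entries `q_{ij} - c` off the diagonal, `0` on the diagonal. -/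
def devMat {n : ℕ} (q : Edge n → ℝ) (c : ℝ) : Matrix (Fin n) (Fin n) ℝ :=
  fun i j => if h : i = j then 0 else q ⟨s(i, j), by simp [Sym2.mk_isDiag_iff, h]⟩ - c

/-- The edge-indicator vector of `G` as a real vector. -/
def ind {n : ℕ} (G : EGraph n) : Edge n → ℝ := fun e => if G e then 1 else 0

/-- `Y_A = ∏_{e ∈ A} Y_e`. -/
def YA {n : ℕ} (A : Finset (Edge n)) (G : EGraph n) : ℝ :=
  ∏ e ∈ A, (if G e then (1:ℝ) else 0)

/-- The event that a configuration agrees with `G0` on the set `W`. -/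
def agreeOn {n : ℕ} (W : Finset (Edge n)) (G0 : EGraph n) : Set (EGraph n) :=
  {G | ∀ w ∈ W, G w = G0 w}

/-- The conditional expectation `E[f | (Y_w)_{w ∈ W}]` under the pmf `μ`, evaluated
at the outcome `G0` (i.e. given that `Y` agrees with `G0` on `W`). -/
def condExpW {n : ℕ} (μ : EGraph n → ℝ) (W : Finset (Edge n)) (f : EGraph n → ℝ)
    (G0 : EGraph n) : ℝ :=
  (∑ G : EGraph n, if G ∈ agreeOn W G0 then μ G * f G else 0) /
    (∑ G : EGraph n, if G ∈ agreeOn W G0 then μ G else 0)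

/-- The pmf of `G(n, p)` conditioned on the lower tail event `L_p(H, η)`. -/
def ltPMF {k : ℕ} (H : SimpleGraph (Fin k)) (n : ℕ) (p η : ℝ) : EGraph n → ℝ :=
  fun G => (if G ∈ lowerTail H n p η then wt (fun _ : Edge n => p) G else 0) /
    pr (fun _ : Edge n => p) (lowerTail H n p η)

/-- The hyperedges of the hypergraph `H(H)`: edge sets of copies of `H` in `K_n`. -/
def copySets {k : ℕ} (H : SimpleGraph (Fin k)) (n : ℕ) : Finset (Finset (Edge n)) :=
  Finset.univ.filter (fun A => ∃ f : Fin k ↪ Fin n,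
    ∀ e : Edge n, e ∈ A ↔ ∃ u v : Fin k, H.Adj u v ∧ (e : Sym2 (Fin n)) = s(f u, f v))

/-- The correlation `D_W(B, b)` as a random variable (a function of the outcome `G0`). -/
def DW {n : ℕ} (μ : EGraph n → ℝ) (W : Finset (Edge n)) (B : Finset (Edge n)) (b : Edge n)
    (G0 : EGraph n) : ℝ :=
  condExpW μ W (YA B) G0 - condExpW μ W (YA (B.erase b)) G0 * condExpW μ W (YA {b}) G0

/-- The energy `E_H(W)` of a set `W` with respect to the pmf `μ`. -/
def energy {k n : ℕ} (H : SimpleGraph (Fin k)) (μ : EGraph n → ℝ) (p : ℝ)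
    (W : Finset (Edge n)) : ℝ :=
  ∑ G0 : EGraph n, μ G0 *
    ∑ A ∈ (copySets H n).filter (fun A => Disjoint A W),
      ∑ B ∈ A.powerset.filter (fun B => 2 ≤ B.card),
        ∑ b ∈ B, (DW μ W B b G0) ^ 2 /
          ((Nat.choose H.edgeSet.ncard B.card : ℝ) * (B.card : ℝ) * p ^ (2 * B.card))

end LowerTails

namespace LowerTails

/-- The probability that a random set containing each element independently with
probability `ε` equals `S`. -/
def binomialWeight {V : Type*} [Fintype V] (ε : ℝ) (S : Finset V) : ℝ :=
  ε ^ S.card * (1 - ε) ^ Sᶜ.card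

lemma binomialWeight_nonneg {V : Type*} [Fintype V] {ε : ℝ} (h0 : 0 ≤ ε) (h1 : ε ≤ 1)
    (S : Finset V) : 0 ≤ binomialWeight ε S :=
  mul_nonneg (pow_nonneg h0 _) (pow_nonneg (by linarith) _)

lemma sum_binomialWeight_ite {V : Type*} [Fintype V] (ε : ℝ) {T R : Finset V}
    (hTR : Disjoint T R) :
    ∑ S : Finset V, (if T ⊆ S ∧ Disjoint R S then binomialWeight ε S else 0) =
      ε ^ T.card * (1 - ε) ^ R.card := by
  have h := Finset.prod_add (fun i : V => if i ∈ R then 0 else ε)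
    (fun i => if i ∈ T then 0 else 1 - ε) Finset.univ
  have hl : ∏ i : V, ((if i ∈ R then 0 else ε) + (if i ∈ T then 0 else 1 - ε)) =
      ε ^ T.card * (1 - ε) ^ R.card := by
    have : ∀ i : V, ((if i ∈ R then 0 else ε) + (if i ∈ T then 0 else 1 - ε)) =
        (if i ∈ T then ε else 1) * (if i ∈ R then 1 - ε else 1) := by
      intro i
      by_cases hT : i ∈ T
      · have hR : i ∉ R := Finset.disjoint_left.1 hTR hT
        simp [hT, hR]
      · by_cases hR : i ∈ R <;> simp [hT, hR]
    simp_rw [this, Finset.prod_mul_distrib, Finset.prod_ite_mem]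
    simp
  rw [← hl, h, Finset.powerset_univ]
  refine Finset.sum_congr rfl fun S _ => ?_
  split_ifs with hS
  · rw [binomialWeight, ← Finset.prod_const, ← Finset.prod_const, Finset.compl_eq_univ_sdiff]
    congr 1
    · exact Finset.prod_congr rfl fun i hi => by
        rw [if_neg fun hR => Finset.disjoint_left.1 hS.2 hR hi]
    · exact Finset.prod_congr rfl fun i hi => by
        rw [if_neg fun hT => (Finset.mem_sdiff.1 hi).2 (hS.1 hT)]
  · rw [not_and_or] at hS
    rcases hS with hS | hS
    · obtain ⟨i, hiT, hiS⟩ := Finset.not_subset.1 hS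
      rw [Finset.prod_eq_zero (s := Finset.univ \ S) (i := i) (by simp [hiS]) (by simp [hiT]),
        mul_zero]
    · obtain ⟨i, hiR, hiS⟩ := Finset.not_disjoint_iff.1 hS
      rw [Finset.prod_eq_zero (s := S) (i := i) hiS (by simp [hiR]), zero_mul]

lemma sum_binomialWeight_subset {V : Type*} [Fintype V] (ε : ℝ) (T : Finset V) :
    ∑ S : Finset V, (if T ⊆ S then binomialWeight ε S else 0) = ε ^ T.card := by
  simpa using sum_binomialWeight_ite ε (Finset.disjoint_empty_right T)

lemma sum_binomialWeight_mul_card {V : Type*} [Fintype V] (ε : ℝ) :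
    ∑ S : Finset V, binomialWeight ε S * S.card = ε * Fintype.card V := by
  have h : ∀ S : Finset V, binomialWeight ε S * S.card =
      ∑ i : V, if {i} ⊆ S then binomialWeight ε S else 0 := by
    intro S
    simp [Finset.sum_ite_mem, mul_comm]
  simp_rw [h]
  rw [Finset.sum_comm]
  simp_rw [sum_binomialWeight_subset]
  simp [mul_comm]

section CondExp

variable {n : ℕ} {μ : EGraph n → ℝ} {W : Finset (Edge n)}

lemma condExpW_congr (f : EGraph n → ℝ) {G G' : EGraph n} (h : ∀ w ∈ W, G w = G' w) :
    condExpW μ W f G = condExpW μ W f G' := by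
  have : agreeOn W G = agreeOn W G' := by
    ext K
    exact forall₂_congr fun w hw => by rw [h w hw]
  rw [condExpW, condExpW, this]

lemma dependsOn_condExpW (f : EGraph n → ℝ) :
    DependsOn (condExpW μ W f) (W : Set (Edge n)) :=
  fun _ _ h => condExpW_congr f fun w hw => h w hw

lemma dependsOn_DW (B : Finset (Edge n)) (b : Edge n) :
    DependsOn (DW μ W B b) (W : Set (Edge n)) := fun G G' h => by
  simp only [DW, dependsOn_condExpW _ h]

lemma dependsOn_YA (A : Finset (Edge n)) : DependsOn (YA A) (A : Set (Edge n)) :=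
  fun _ _ h => Finset.prod_congr rfl fun e he => by rw [h e he]

lemma sum_mul_condExpW (hμ : ∀ G, 0 ≤ μ G) {h : EGraph n → ℝ}
    (hh : DependsOn h (W : Set (Edge n))) (f : EGraph n → ℝ) :
    ∑ G, μ G * (h G * condExpW μ W f G) = ∑ G, μ G * (h G * f G) := by
  set Z : EGraph n → ℝ := fun G => ∑ G', if G' ∈ agreeOn W G then μ G' else 0 with hZ
  have hsymm : ∀ G G' : EGraph n, G' ∈ agreeOn W G ↔ G ∈ agreeOn W G' := fun G G' =>
    forall₂_congr fun _ _ => eq_comm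
  have hZc : ∀ G G' : EGraph n, G' ∈ agreeOn W G → Z G' = Z G := by
    intro G G' hG
    have : agreeOn W G' = agreeOn W G := by
      ext K
      exact forall₂_congr fun w hw => by rw [hG w hw]
    simp only [hZ, this]
  calc ∑ G, μ G * (h G * condExpW μ W f G)
      = ∑ G, ∑ G', if G' ∈ agreeOn W G then μ G * h G * (μ G' * f G') / Z G else 0 := by
        refine Finset.sum_congr rfl fun G _ => ?_
        rw [condExpW, ← mul_assoc, ← mul_div_assoc, Finset.mul_sum, Finset.sum_div]
        refine Finset.sum_congr rfl fun G' _ => ?_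
        split_ifs <;> simp [hZ]
    _ = ∑ G', ∑ G, if G ∈ agreeOn W G' then μ G' * f G' * h G' / Z G' * μ G else 0 := by
        rw [Finset.sum_comm]
        refine Finset.sum_congr rfl fun G' _ => Finset.sum_congr rfl fun G _ => ?_
        by_cases hG : G' ∈ agreeOn W G
        · rw [if_pos hG, if_pos ((hsymm _ _).1 hG), hZc G G' hG,
            hh (fun w hw => hG w hw : ∀ w ∈ (W : Set (Edge n)), G' w = G w)]
          ring
        · rw [if_neg hG, if_neg fun h' => hG ((hsymm _ _).2 h')]
    _ = ∑ G', μ G' * f G' * h G' / Z G' * Z G' := by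
        refine Finset.sum_congr rfl fun G' _ => ?_
        simp only [hZ]
        rw [Finset.mul_sum]
        exact Finset.sum_congr rfl fun G _ => by split_ifs <;> simp
    _ = ∑ G, μ G * (h G * f G) := by
        refine Finset.sum_congr rfl fun G _ => ?_
        by_cases h0 : Z G = 0
        · have hle : μ G ≤ Z G := by
            have := Finset.single_le_sum (f := fun G' => if G' ∈ agreeOn W G then μ G' else 0)
              (fun G' _ => by split_ifs; exacts [hμ _, le_rfl]) (Finset.mem_univ G)
            rwa [if_pos (show G ∈ agreeOn W G from fun _ _ => rfl)] at this
          have : μ G = 0 := le_antisymm (h0 ▸ hle) (hμ G)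
          simp [this]
        · field_simp

lemma YA_nonneg (A : Finset (Edge n)) (G : EGraph n) : 0 ≤ YA A G :=
  Finset.prod_nonneg fun _ _ => by split_ifs <;> simp

lemma YA_mul_YA (A B : Finset (Edge n)) (G : EGraph n) : YA A G * YA B G = YA (A ∪ B) G := by
  have h : ∀ A : Finset (Edge n), YA A G = if ∀ e ∈ A, G e = true then 1 else 0 := by
    intro A
    rw [YA, Finset.prod_boole]
    congr
  have hu : (∀ e ∈ A ∪ B, G e = true) ↔ (∀ e ∈ A, G e = true) ∧ ∀ e ∈ B, G e = true := by
    simp only [Finset.mem_union, or_imp, forall_and]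
  rw [h, h, h, if_congr hu rfl rfl]
  split_ifs <;> first | (exfalso; tauto) | simp

lemma condExpW_nonneg (hμ : ∀ G, 0 ≤ μ G) {f : EGraph n → ℝ} (hf : ∀ G, 0 ≤ f G)
    (G : EGraph n) : 0 ≤ condExpW μ W f G := by
  refine div_nonneg (Finset.sum_nonneg fun G _ => ?_) (Finset.sum_nonneg fun G _ => ?_)
  · split_ifs
    exacts [mul_nonneg (hμ _) (hf _), le_rfl]
  · split_ifs
    exacts [hμ _, le_rfl]

/-- Pythagoras for conditional expectations with respect to nested sets. -/
lemma sum_sq_condExpW_sub (hμ : ∀ G, 0 ≤ μ G) {U : Finset (Edge n)} (hU : W ⊆ U)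
    (f : EGraph n → ℝ) :
    ∑ G, μ G * (condExpW μ U f G - condExpW μ W f G) ^ 2 =
      ∑ G, μ G * condExpW μ U f G ^ 2 - ∑ G, μ G * condExpW μ W f G ^ 2 := by
  have h1 := sum_mul_condExpW hμ (dependsOn_condExpW (μ := μ) (W := W) f) f
  have h2 := sum_mul_condExpW (W := U) hμ
    (h := condExpW μ W f) ((dependsOn_condExpW f).mono (by exact_mod_cast hU)) f
  have : ∀ G, μ G * (condExpW μ U f G - condExpW μ W f G) ^ 2 =
      μ G * condExpW μ U f G ^ 2 + μ G * condExpW μ W f G ^ 2 -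
        2 * (μ G * (condExpW μ W f G * condExpW μ U f G)) := fun G => by ring
  simp_rw [this, Finset.sum_sub_distrib, Finset.sum_add_distrib, ← Finset.mul_sum]
  rw [h2, ← h1]
  have : ∀ G, μ G * (condExpW μ W f G * condExpW μ W f G) = μ G * condExpW μ W f G ^ 2 :=
    fun G => by ring
  simp_rw [this]
  ring

lemma sum_mul_YA_erase_mul_condExpW_sub (hμ : ∀ G, 0 ≤ μ G) {U B : Finset (Edge n)}
    {b : Edge n} (hU : W ⊆ U) (hb : b ∈ B) (hB : B.erase b ⊆ U) {h : EGraph n → ℝ}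
    (hh : DependsOn h (W : Set (Edge n))) :
    ∑ G, μ G * (h G * YA (B.erase b) G * (condExpW μ U (YA {b}) G - condExpW μ W (YA {b}) G)) =
      ∑ G, μ G * (h G * DW μ W B b G) := by
  have e1 := sum_mul_condExpW (W := U) hμ (h := fun G => h G * YA (B.erase b) G)
    (fun G G' hG => by
      dsimp only
      rw [hh fun w hw => hG w (hU hw), dependsOn_YA (B.erase b) fun w hw => hG w (hB hw)])
    (YA {b})
  have e2 := sum_mul_condExpW (W := W) hμ (h := fun G => h G * condExpW μ W (YA {b}) G)
    (fun G G' hG => by dsimp only; rw [hh hG, dependsOn_condExpW _ hG]) (YA (B.erase b))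
  have e3 := sum_mul_condExpW hμ hh (YA B)
  have e4 : ∀ G, h G * YA (B.erase b) G * YA {b} G = h G * YA B G := by
    intro G
    rw [mul_assoc, YA_mul_YA]
    congr 2
    ext x
    by_cases hx : x = b <;> simp [hx, hb]
  simp_rw [e4] at e1
  have l : ∀ G, μ G * (h G * YA (B.erase b) G *
      (condExpW μ U (YA {b}) G - condExpW μ W (YA {b}) G)) =
      μ G * (h G * YA (B.erase b) G * condExpW μ U (YA {b}) G) -
        μ G * (h G * condExpW μ W (YA {b}) G * YA (B.erase b) G) := fun G => by ring
  have r : ∀ G, μ G * (h G * DW μ W B b G) = μ G * (h G * condExpW μ W (YA B) G) -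
      μ G * (h G * condExpW μ W (YA {b}) G * condExpW μ W (YA (B.erase b)) G) := fun G => by
    rw [DW]; ring
  simp_rw [l, r, Finset.sum_sub_distrib]
  rw [e1, e2, e3]

lemma abs_DW_le (hμ : ∀ G, 0 ≤ μ G) {p : ℝ} (hp : 0 ≤ p)
    (hY : ∀ A : Finset (Edge n), Disjoint A W →
      ∀ G, 0 < μ G → condExpW μ W (YA A) G ≤ p ^ A.card)
    {B : Finset (Edge n)} (hB : Disjoint B W) {b : Edge n} (hb : b ∈ B) {G : EGraph n}
    (hG : 0 < μ G) : |DW μ W B b G| ≤ p ^ B.card := by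
  have h1 := hY B hB G hG
  have h2 := hY (B.erase b) (hB.mono_left (Finset.erase_subset _ _)) G hG
  have h3 := hY {b} (hB.mono_left (by simpa using hb)) G hG
  have n1 := condExpW_nonneg (W := W) hμ (YA_nonneg B) G
  have n2 := condExpW_nonneg (W := W) hμ (YA_nonneg (B.erase b)) G
  have n3 := condExpW_nonneg (W := W) hμ (YA_nonneg {b}) G
  have h4 := mul_le_mul h2 h3 n3 (pow_nonneg hp _)
  rw [← pow_add, Finset.card_singleton, Finset.card_erase_add_one hb] at h4
  have n4 := mul_nonneg n2 n3
  rw [DW, abs_le]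
  constructor <;> linarith

lemma sum_mul_YA_le (hμ1 : ∑ G, μ G = 1) {p : ℝ}
    {A : Finset (Edge n)} (hY : ∀ G, 0 < μ G → condExpW μ ∅ (YA A) G ≤ p ^ A.card) :
    ∑ G, μ G * YA A G ≤ p ^ A.card := by
  obtain ⟨G, -, hG⟩ := Finset.exists_lt_of_sum_lt
    (s := Finset.univ) (f := fun _ : EGraph n => (0 : ℝ)) (g := μ) (by simp [hμ1])
  simpa [condExpW, agreeOn, hμ1] using hY G hG

end CondExp

section Increment

variable {n : ℕ} {μ : EGraph n → ℝ} {W : Finset (Edge n)} {p ε : ℝ}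

/-- The weighted number of pairs `(A, B) ∈ P` with `b ∈ B` such that the remaining elements of
`B` lie in `S` and are present in `G`, weighted by the correlations `D_W(B, b)`. -/
def correlationSum (μ : EGraph n → ℝ) (W : Finset (Edge n)) (c : Finset (Edge n) → ℝ)
    (P : Finset (Finset (Edge n) × Finset (Edge n))) (b : Edge n) (S : Finset (Edge n))
    (G : EGraph n) : ℝ :=
  ∑ x ∈ P, if b ∈ x.2 ∧ x.2.erase b ⊆ S then c x.2 * DW μ W x.2 b G * YA (x.2.erase b) G else 0

lemma sum_correlationSum_mul_sub (hμ : ∀ G, 0 ≤ μ G) (c : Finset (Edge n) → ℝ)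
    (P : Finset (Finset (Edge n) × Finset (Edge n))) (b : Edge n) (S : Finset (Edge n)) :
    ∑ G, μ G * (correlationSum μ W c P b S G *
        (condExpW μ (W ∪ S) (YA {b}) G - condExpW μ W (YA {b}) G)) =
      ∑ x ∈ P, if b ∈ x.2 ∧ x.2.erase b ⊆ S then c x.2 * ∑ G, μ G * DW μ W x.2 b G ^ 2
        else 0 := by
  simp_rw [correlationSum, Finset.sum_mul, Finset.mul_sum]
  rw [Finset.sum_comm]
  refine Finset.sum_congr rfl fun x _ => ?_
  split_ifs with hx
  · have h := sum_mul_YA_erase_mul_condExpW_sub (W := W) (U := W ∪ S) (B := x.2) hμ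
      Finset.subset_union_left hx.1 (hx.2.trans Finset.subset_union_right)
      (h := DW μ W x.2 b) (dependsOn_DW _ _)
    calc _ = c x.2 * ∑ G, μ G * (DW μ W x.2 b G * YA (x.2.erase b) G *
          (condExpW μ (W ∪ S) (YA {b}) G - condExpW μ W (YA {b}) G)) := by
          rw [Finset.mul_sum]
          exact Finset.sum_congr rfl fun G _ => by ring
      _ = _ := by
          rw [h, Finset.mul_sum]
          exact Finset.sum_congr rfl fun G _ => by ring
  · simp

lemma sum_binomialWeight_mul_sum_correlationSum (hμ : ∀ G, 0 ≤ μ G) (ε : ℝ)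
    (c : Finset (Edge n) → ℝ) (P : Finset (Finset (Edge n) × Finset (Edge n))) (b : Edge n) :
    ∑ S, (if b ∉ S then binomialWeight ε S else 0) *
        ∑ G, μ G * (correlationSum μ W c P b S G *
          (condExpW μ (W ∪ S) (YA {b}) G - condExpW μ W (YA {b}) G)) =
      ∑ x ∈ P, if b ∈ x.2 then ε ^ (x.2.card - 1) * (1 - ε) *
        (c x.2 * ∑ G, μ G * DW μ W x.2 b G ^ 2) else 0 := by
  simp_rw [sum_correlationSum_mul_sub hμ, Finset.mul_sum (s := P)]
  rw [Finset.sum_comm]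
  refine Finset.sum_congr rfl fun x _ => ?_
  split_ifs with hb
  · have h := sum_binomialWeight_ite ε (T := x.2.erase b) (R := {b}) (by simp)
    rw [Finset.card_erase_of_mem hb, Finset.card_singleton, pow_one] at h
    rw [← h, Finset.sum_mul]
    refine Finset.sum_congr rfl fun S _ => ?_
    by_cases h1 : b ∈ S <;> by_cases h2 : x.2.erase b ⊆ S <;> simp [h1, h2, hb]
  · simp [hb]

lemma sum_binomialWeight_mul_sum_sq_correlationSum_le (hμ : ∀ G, 0 ≤ μ G)
    (hμ1 : ∑ G, μ G = 1) (hp : 0 ≤ p)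
    (hY : ∀ W A : Finset (Edge n), Disjoint A W →
      ∀ G, 0 < μ G → condExpW μ W (YA A) G ≤ p ^ A.card)
    (hε : 0 ≤ ε) (hε1 : ε ≤ 1) {c : Finset (Edge n) → ℝ} (hc : ∀ B, 0 ≤ c B)
    {P : Finset (Finset (Edge n) × Finset (Edge n))} (hP : ∀ x ∈ P, Disjoint x.2 W)
    (b : Edge n) :
    ∑ S, binomialWeight ε S * ∑ G, μ G * correlationSum μ W c P b S G ^ 2 ≤
      ∑ x ∈ P, ∑ y ∈ P, if b ∈ x.2 ∩ y.2 then
        (c x.2 * p ^ x.2.card) * (c y.2 * p ^ y.2.card) * (ε * p) ^ ((x.2 ∪ y.2).erase b).card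
        else 0 := by
  have hexp : ∀ S, binomialWeight ε S * ∑ G, μ G * correlationSum μ W c P b S G ^ 2 =
      ∑ x ∈ P, ∑ y ∈ P, binomialWeight ε S * ∑ G, μ G *
        ((if b ∈ x.2 ∧ x.2.erase b ⊆ S then
            c x.2 * DW μ W x.2 b G * YA (x.2.erase b) G else 0) *
          (if b ∈ y.2 ∧ y.2.erase b ⊆ S then
            c y.2 * DW μ W y.2 b G * YA (y.2.erase b) G else 0)) := by
    intro S
    simp_rw [← Finset.mul_sum]
    congr 1
    symm
    refine (Finset.sum_congr rfl fun x _ => Finset.sum_comm).trans (Finset.sum_comm.trans ?_)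
    refine Finset.sum_congr rfl fun G _ => ?_
    simp_rw [← Finset.mul_sum, ← Finset.sum_mul, correlationSum, sq]
  simp_rw [hexp]
  rw [Finset.sum_comm]
  refine Finset.sum_le_sum fun x hx => ?_
  rw [Finset.sum_comm]
  refine Finset.sum_le_sum fun y hy => ?_
  by_cases hbx : b ∈ x.2
  swap
  · simp [hbx]
  by_cases hby : b ∈ y.2
  swap
  · simp [hby]
  rw [if_pos (Finset.mem_inter.2 ⟨hbx, hby⟩)]
  set U := (x.2 ∪ y.2).erase b with hU
  have hUe : x.2.erase b ∪ y.2.erase b = U := by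
    rw [hU, Finset.erase_union_distrib]
  have hYU := sum_mul_YA_le (A := U) hμ1 (hY ∅ U (Finset.disjoint_empty_right _))
  set C := (c x.2 * p ^ x.2.card) * (c y.2 * p ^ y.2.card) with hC
  have hC0 : 0 ≤ C := mul_nonneg (mul_nonneg (hc _) (pow_nonneg hp _))
    (mul_nonneg (hc _) (pow_nonneg hp _))
  calc _ ≤ ∑ S, (if U ⊆ S then binomialWeight ε S else 0) * (C * p ^ U.card) := by
        refine Finset.sum_le_sum fun S _ => ?_
        have hw := binomialWeight_nonneg hε hε1 S
        by_cases hS : U ⊆ S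
        · have h1 : x.2.erase b ⊆ S := fun i hi => hS (hUe ▸ Finset.mem_union_left _ hi)
          have h2 : y.2.erase b ⊆ S := fun i hi => hS (hUe ▸ Finset.mem_union_right _ hi)
          rw [if_pos hS]
          refine mul_le_mul_of_nonneg_left ?_ hw
          refine le_trans ?_ (mul_le_mul_of_nonneg_left hYU hC0)
          rw [Finset.mul_sum]
          refine Finset.sum_le_sum fun G _ => ?_
          rw [if_pos ⟨hbx, h1⟩, if_pos ⟨hby, h2⟩]
          rcases (hμ G).eq_or_lt with h0 | h0
          · simp [← h0]
          have d1 := abs_DW_le hμ hp (hY W) (hP x hx) hbx h0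
          have d2 := abs_DW_le hμ hp (hY W) (hP y hy) hby h0
          have d3 : DW μ W x.2 b G * DW μ W y.2 b G ≤ p ^ x.2.card * p ^ y.2.card := by
            refine (le_abs_self _).trans ?_
            rw [abs_mul]
            exact mul_le_mul d1 d2 (abs_nonneg _) (pow_nonneg hp _)
          have hn : 0 ≤ μ G * (c x.2 * c y.2 * YA U G) :=
            mul_nonneg h0.le (mul_nonneg (mul_nonneg (hc _) (hc _)) (YA_nonneg _ _))
          calc _ = μ G * (c x.2 * c y.2 * (YA (x.2.erase b) G * YA (y.2.erase b) G)) *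
                (DW μ W x.2 b G * DW μ W y.2 b G) := by ring
            _ ≤ μ G * (c x.2 * c y.2 * YA U G) * (p ^ x.2.card * p ^ y.2.card) := by
                rw [YA_mul_YA, hUe]
                exact mul_le_mul_of_nonneg_left d3 hn
            _ = _ := by rw [hC]; ring
        · rw [if_neg hS, zero_mul]
          refine le_of_eq (mul_eq_zero_of_right _ (Finset.sum_eq_zero fun G _ => ?_))
          rw [← hUe, Finset.union_subset_iff, not_and_or] at hS
          rcases hS with hS | hS <;> simp [hS]
    _ = C * (ε * p) ^ U.card := by
        have hsub : ∑ S, (if U ⊆ S then binomialWeight ε S else 0) = ε ^ U.card := by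
          convert sum_binomialWeight_subset ε U
        rw [← Finset.sum_mul, hsub, mul_pow]
        ring

/-- If enlarging `W` by any set `S` raises the expected squares of the conditional expectations
outside of `W ∪ S` by at most `K * |S|`, then the correlations on `P` are controlled by their
second moment. -/
lemma correlation_le_of_increment_le (hμ : ∀ G, 0 ≤ μ G) (hμ1 : ∑ G, μ G = 1) (hp : 0 < p)
    (hY : ∀ W A : Finset (Edge n), Disjoint A W →
      ∀ G, 0 < μ G → condExpW μ W (YA A) G ≤ p ^ A.card)
    (hε : 0 < ε) (hε1 : ε ≤ 1) {a : Finset (Edge n) → ℝ} (ha : ∀ B, 0 ≤ a B)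
    (ha1 : ∀ B, a B ≤ 1)
    {P : Finset (Finset (Edge n) × Finset (Edge n))} (hP : ∀ x ∈ P, Disjoint x.2 W) {K : ℝ}
    (hK : ∀ S, ∑ b, (if b ∉ W ∪ S then ∑ G, μ G * condExpW μ (W ∪ S) (YA {b}) G ^ 2 -
      ∑ G, μ G * condExpW μ W (YA {b}) G ^ 2 else 0) ≤ K * S.card) (θ : ℝ) :
    2 * θ * ((1 - ε) * p * ∑ x ∈ P, ∑ b ∈ x.2,
        a x.2 * (∑ G, μ G * DW μ W x.2 b G ^ 2) / p ^ (2 * x.2.card)) -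
      θ ^ 2 * ∑ x ∈ P, ∑ y ∈ P, ∑ _b ∈ x.2 ∩ y.2, ((ε * p) ^ ((x.2 ∩ y.2).card - 1))⁻¹ ≤
    K * (ε * Fintype.card (Edge n)) := by
  set c : Finset (Edge n) → ℝ :=
    fun B => a B / (p ^ B.card * (ε * p) ^ (B.card - 1)) with hc
  have hεp : 0 < ε * p := mul_pos hε hp
  have hc0 : ∀ B, 0 ≤ c B := fun B => by
    have := ha B
    simp only [hc]
    positivity
  set q : Finset (Edge n) → Edge n → EGraph n → ℝ := fun U b => condExpW μ U (YA {b}) with hq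
  set X := correlationSum μ W c P with hX
  have hXW : ∀ b ∈ W, ∀ S G, X b S G = 0 := fun b hb S G =>
    Finset.sum_eq_zero fun x hx => if_neg fun h =>
      Finset.disjoint_left.1 (hP x hx) h.1 hb
  have hS : ∀ S, ∑ b, (2 * θ * ((if b ∉ S then 1 else 0) *
      ∑ G, μ G * (X b S G * (q (W ∪ S) b G - q W b G))) -
        θ ^ 2 * ∑ G, μ G * X b S G ^ 2) ≤ K * S.card := by
    intro S
    refine le_trans (Finset.sum_le_sum fun b _ => ?_) (hK S)
    have hXn : 0 ≤ θ ^ 2 * ∑ G, μ G * X b S G ^ 2 :=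
      mul_nonneg (sq_nonneg _) (Finset.sum_nonneg fun G _ => mul_nonneg (hμ G) (sq_nonneg _))
    by_cases hbS : b ∈ S
    · simp [hbS, hXn]
    by_cases hbW : b ∈ W
    · simp [hbW, hXW b hbW]
    rw [if_pos hbS, if_pos (by simp [hbS, hbW]),
      ← sum_sq_condExpW_sub hμ Finset.subset_union_left, one_mul, Finset.mul_sum,
      Finset.mul_sum, ← Finset.sum_sub_distrib]
    refine Finset.sum_le_sum fun G _ => ?_
    have := mul_nonneg (hμ G) (sq_nonneg (q (W ∪ S) b G - q W b G - θ * X b S G))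
    simp only [hq] at this ⊢
    nlinarith
  have hsum := Finset.sum_le_sum fun S (_ : S ∈ Finset.univ) =>
    mul_le_mul_of_nonneg_left (hS S) (binomialWeight_nonneg hε.le hε1 S)
  have hr : ∑ S : Finset (Edge n), binomialWeight ε S * (K * S.card) =
      K * (ε * Fintype.card (Edge n)) := by
    rw [← sum_binomialWeight_mul_card, Finset.mul_sum]
    exact Finset.sum_congr rfl fun S _ => by ring
  rw [hr] at hsum
  refine le_trans ?_ hsum
  have hl : ∑ S, binomialWeight ε S * ∑ b, (2 * θ * ((if b ∉ S then 1 else 0) *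
      ∑ G, μ G * (X b S G * (q (W ∪ S) b G - q W b G))) -
        θ ^ 2 * ∑ G, μ G * X b S G ^ 2) =
      2 * θ * (∑ b, ∑ S, (if b ∉ S then binomialWeight ε S else 0) *
        ∑ G, μ G * (X b S G * (q (W ∪ S) b G - q W b G))) -
      θ ^ 2 * ∑ b, ∑ S, binomialWeight ε S * ∑ G, μ G * X b S G ^ 2 := by
    rw [Finset.sum_comm (s := Finset.univ) (t := Finset.univ) (f := fun b S =>
      (if b ∉ S then binomialWeight ε S else 0) * _),
      Finset.sum_comm (s := Finset.univ) (t := Finset.univ) (f := fun b S =>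
      binomialWeight ε S * _), Finset.mul_sum, Finset.mul_sum, ← Finset.sum_sub_distrib]
    refine Finset.sum_congr rfl fun S _ => ?_
    rw [Finset.mul_sum, Finset.mul_sum, Finset.mul_sum, ← Finset.sum_sub_distrib]
    refine Finset.sum_congr rfl fun b _ => ?_
    split_ifs <;> ring
  rw [hl]
  refine sub_le_sub (le_of_eq ?_) (mul_le_mul_of_nonneg_left ?_ (sq_nonneg θ))
  · congr 1
    simp_rw [hX, hq, sum_binomialWeight_mul_sum_correlationSum hμ]
    rw [Finset.sum_comm, Finset.mul_sum]
    refine Finset.sum_congr rfl fun x _ => ?_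
    rw [Finset.sum_ite_mem, Finset.univ_inter, Finset.mul_sum]
    refine Finset.sum_congr rfl fun b hb => ?_
    obtain ⟨t, ht⟩ := Nat.exists_eq_add_of_lt (Finset.card_pos.2 ⟨b, hb⟩)
    simp only [hc, ht, zero_add, Nat.add_sub_cancel]
    field_simp
    ring
  · refine le_trans (Finset.sum_le_sum fun b _ =>
      sum_binomialWeight_mul_sum_sq_correlationSum_le hμ hμ1 hp.le hY hε.le hε1 hc0 hP b) ?_
    rw [Finset.sum_comm]
    refine Finset.sum_le_sum fun x _ => ?_
    rw [Finset.sum_comm]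
    refine Finset.sum_le_sum fun y _ => ?_
    rw [Finset.sum_ite_mem, Finset.univ_inter]
    refine Finset.sum_le_sum fun b hb => ?_
    obtain ⟨hbx, hby⟩ := Finset.mem_inter.1 hb
    have hcp : ∀ B, c B * p ^ B.card ≤ ((ε * p) ^ (B.card - 1))⁻¹ := by
      intro B
      have : c B * p ^ B.card = a B * ((ε * p) ^ (B.card - 1))⁻¹ := by
        simp only [hc]
        field_simp
      rw [this]
      exact mul_le_of_le_one_left (by positivity) (ha1 B)
    have hcp0 : ∀ B, 0 ≤ c B * p ^ B.card := fun B => mul_nonneg (hc0 B) (by positivity)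
    calc _ ≤ ((ε * p) ^ (x.2.card - 1))⁻¹ * ((ε * p) ^ (y.2.card - 1))⁻¹ *
          (ε * p) ^ ((x.2 ∪ y.2).erase b).card := by
          refine mul_le_mul_of_nonneg_right ?_ (by positivity)
          exact mul_le_mul (hcp _) (hcp _) (hcp0 _) (by positivity)
      _ = _ := by
          rw [Finset.card_erase_of_mem (Finset.mem_union_left _ hbx)]
          have h1 := Finset.card_union_add_card_inter x.2 y.2
          have h2 := Finset.card_pos.2 ⟨b, hb⟩
          have h3 := Finset.card_pos.2 ⟨b, hbx⟩
          have h4 := Finset.card_pos.2 ⟨b, hby⟩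
          have h5 := Finset.card_pos.2 ⟨b, Finset.mem_union_left y.2 hbx⟩
          have h6 : (x.2.card - 1) + (y.2.card - 1) =
              ((x.2 ∪ y.2).card - 1) + ((x.2 ∩ y.2).card - 1) := by omega
          rw [← mul_inv, ← pow_add, h6, pow_add]
          field_simp

end Increment

section Copies

variable {k n : ℕ} (H : SimpleGraph (Fin k))

/-- The edge set of the copy of `H` in `K_n` given by an embedding of its vertices. -/
def copyEdges (f : Fin k ↪ Fin n) : Finset (Edge n) :=
  Finset.univ.filter fun e => (e : Sym2 (Fin n)) ∈ Sym2.map f '' H.edgeSet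

lemma mem_copyEdges_iff {f : Fin k ↪ Fin n} {e : Edge n} : e ∈ copyEdges H f ↔
    ∃ u v : Fin k, H.Adj u v ∧ (e : Sym2 (Fin n)) = s(f u, f v) := by
  simp only [copyEdges, Finset.mem_filter, Finset.mem_univ, true_and, Set.mem_image]
  constructor
  · rintro ⟨⟨u, v⟩, h, he⟩
    exact ⟨u, v, h, he.symm⟩
  · rintro ⟨u, v, h, he⟩
    exact ⟨s(u, v), h, he.symm⟩

lemma mem_copySets_iff {A : Finset (Edge n)} :
    A ∈ copySets H n ↔ ∃ f : Fin k ↪ Fin n, copyEdges H f = A := by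
  simp only [copySets, Finset.mem_filter, Finset.mem_univ, true_and, ← mem_copyEdges_iff]
  exact exists_congr fun f => ⟨fun h => (Finset.ext h).symm, fun h e => by rw [h]⟩

lemma coe_map_copyEdges (f : Fin k ↪ Fin n) :
    ((copyEdges H f).map (Function.Embedding.subtype _) : Set (Sym2 (Fin n))) =
      Sym2.map f '' H.edgeSet := by
  ext e
  simp only [copyEdges, Finset.coe_map, Set.mem_image, Finset.mem_coe, Finset.mem_filter,
    Finset.mem_univ, true_and, Function.Embedding.subtype_apply]
  constructor
  · rintro ⟨a, h, rfl⟩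
    exact h
  · rintro ⟨a, h, rfl⟩
    have hd : ¬ (Sym2.map f a).IsDiag := by
      rw [Sym2.isDiag_map f.injective]
      exact H.not_isDiag_of_mem_edgeSet h
    exact ⟨⟨_, hd⟩, ⟨a, h, rfl⟩, rfl⟩

lemma copyEdges_eq_iff {f g : Fin k ↪ Fin n} :
    copyEdges H f = copyEdges H g ↔ Sym2.map f '' H.edgeSet = Sym2.map g '' H.edgeSet := by
  rw [← coe_map_copyEdges, ← coe_map_copyEdges, Finset.coe_inj, Finset.map_inj]

lemma card_copyEdges_inter (f g : Fin k ↪ Fin n) :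
    (copyEdges H f ∩ copyEdges H g).card =
      (H.edgeFinset.filter fun e => Sym2.map f e ∈ Sym2.map g '' H.edgeSet).card := by
  rw [← Finset.card_map (Function.Embedding.subtype _),
    ← Finset.card_image_of_injective _ (Sym2.map.injective f.injective)]
  congr 1
  rw [← Finset.coe_inj, Finset.map_inter, Finset.coe_inter, coe_map_copyEdges,
    coe_map_copyEdges]
  ext e
  simp only [Set.mem_inter_iff, Set.mem_image, Finset.coe_image, Finset.coe_filter,
    Set.mem_ofPred_eq, SimpleGraph.mem_edgeFinset]
  constructor
  · rintro ⟨⟨a, ha, rfl⟩, h⟩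
    exact ⟨a, ⟨ha, h⟩, rfl⟩
  · rintro ⟨a, ⟨ha, h⟩, rfl⟩
    exact ⟨⟨a, ha, rfl⟩, h⟩

lemma card_copyEdges (f : Fin k ↪ Fin n) : (copyEdges H f).card = H.edgeFinset.card := by
  have := card_copyEdges_inter H f f
  rw [Finset.inter_self] at this
  rw [this, Finset.filter_true_of_mem]
  exact fun e he => ⟨e, by simpa using he, rfl⟩

lemma card_copyEdges_fiber_le (f₀ f₁ : Fin k ↪ Fin n) :
    (Finset.univ.filter fun f => copyEdges H f = copyEdges H f₀).card ≤
      (Finset.univ.filter fun f => copyEdges H f = copyEdges H f₁).card := by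
  obtain ⟨σ, hσ⟩ := (Equiv.Perm.isMultiplyPretransitive (Fin n) k).exists_smul_eq f₀ f₁
  have hσ' : ∀ i, σ (f₀ i) = f₁ i := fun i => by rw [← hσ]; rfl
  have hcomp : ∀ f g : Fin k ↪ Fin n, (∀ i, σ (f i) = g i) →
      Sym2.map g '' H.edgeSet = Sym2.map σ '' (Sym2.map f '' H.edgeSet) := by
    intro f g h
    rw [Set.image_image]
    refine Set.image_congr fun e _ => ?_
    rw [Sym2.map_map]
    congr 1
    exact funext fun i => (h i).symm
  refine Finset.card_le_card_of_injOn (fun f => f.trans σ.toEmbedding) ?_ ?_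
  · intro f hf
    simp only [Finset.coe_filter, Finset.mem_univ, true_and, Set.mem_ofPred_eq,
      copyEdges_eq_iff] at hf ⊢
    rw [hcomp f _ fun _ => rfl, hf, ← hcomp f₀ f₁ hσ']
  · intro f _ g _ h
    refine DFunLike.ext _ _ fun i => ?_
    simpa using DFunLike.congr_fun h i

/-- All copies of `H` arise from the same number of embeddings. -/
lemma exists_mul_sum_copySets [Nonempty (Fin k ↪ Fin n)] : ∃ z : ℝ, 0 < z ∧
    ∀ g : Finset (Edge n) → ℝ,
      z * ∑ A ∈ copySets H n, g A = ∑ f : Fin k ↪ Fin n, g (copyEdges H f) := by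
  obtain ⟨f₀⟩ := ‹Nonempty (Fin k ↪ Fin n)›
  refine ⟨(Finset.univ.filter fun f => copyEdges H f = copyEdges H f₀).card, ?_, fun g => ?_⟩
  · exact_mod_cast Finset.card_pos.2 ⟨f₀, by simp⟩
  rw [← Finset.sum_fiberwise_of_maps_to (t := copySets H n)
    (fun f _ => (mem_copySets_iff H).2 ⟨f, rfl⟩), Finset.mul_sum]
  refine Finset.sum_congr rfl fun A hA => ?_
  obtain ⟨f₁, rfl⟩ := (mem_copySets_iff H).1 hA
  rw [Finset.sum_congr rfl fun f hf => by rw [(Finset.mem_filter.1 hf).2], Finset.sum_const,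
    nsmul_eq_mul,
    le_antisymm (card_copyEdges_fiber_le H f₀ f₁) (card_copyEdges_fiber_le H f₁ f₀)]

lemma card_copySets_le : ((copySets H n).card : ℝ) ≤ NHKn H n := by
  have hs : ∀ A ∈ copySets H n, ∃ K : (⊤ : SimpleGraph (Fin n)).Subgraph,
      Nonempty (H ≃g K.coe) ∧ ∀ e : Edge n, e ∈ A ↔ (e : Sym2 (Fin n)) ∈ K.edgeSet := by
    intro A hA
    obtain ⟨f, rfl⟩ := (mem_copySets_iff H).1 hA
    let F : SimpleGraph.Copy H (⊤ : SimpleGraph (Fin n)) :=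
      ⟨⟨f, fun h => by simpa using h.ne⟩, f.injective⟩
    refine ⟨F.toSubgraph, ⟨F.isoToSubgraph⟩, fun e => ?_⟩
    rw [copyEdges, Finset.mem_filter, SimpleGraph.Copy.toSubgraph,
      SimpleGraph.Subgraph.edgeSet_map, SimpleGraph.Subgraph.edgeSet_top]
    simp only [Finset.mem_univ, true_and]
    rfl
  choose! κ hκ using hs
  rw [NHKn, countCopies, Nat.cast_le, ← Set.ncard_coe_finset]
  refine Set.ncard_le_ncard_of_injOn κ (fun A hA => (hκ A hA).1) ?_ (Set.toFinite _)
  intro A hA B hB h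
  ext e
  rw [(hκ A hA).2, (hκ B hB).2, h]

/-- The vertices covered by a set of edges. -/
def support (J : Finset (Sym2 (Fin k))) : Finset (Fin k) :=
  Finset.univ.filter fun v => ∃ e ∈ J, v ∈ e

variable {H}

lemma toFinset_subset_support {J : Finset (Sym2 (Fin k))} {e : Sym2 (Fin k)} (he : e ∈ J) :
    e.toFinset ⊆ support J := fun v hv => by
  simpa [support] using ⟨e, he, by simpa using hv⟩

lemma card_toFinset_of_mem_edgeFinset {e : Sym2 (Fin k)} (he : e ∈ H.edgeFinset) :
    e.toFinset.card = 2 :=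
  Sym2.card_toFinset_of_not_isDiag _ (H.not_isDiag_of_mem_edgeSet (by simpa using he))

lemma two_le_card_support {J : Finset (Sym2 (Fin k))} (hJ : J ⊆ H.edgeFinset)
    (hJ0 : J.Nonempty) : 2 ≤ (support J).card := by
  obtain ⟨e, he⟩ := hJ0
  rw [← card_toFinset_of_mem_edgeFinset (hJ he)]
  exact Finset.card_le_card (toFinset_subset_support he)

lemma two_lt_card_support {J : Finset (Sym2 (Fin k))} (hJ : J ⊆ H.edgeFinset)
    (hJ2 : 2 ≤ J.card) : 2 < (support J).card := by
  obtain ⟨e₁, h₁, e₂, h₂, hne⟩ := Finset.one_lt_card.1 hJ2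
  by_contra! hle
  refine hne (Sym2.ext fun v => ?_)
  have h : ∀ e ∈ J, e.toFinset = support J := fun e he =>
    Finset.eq_of_subset_of_card_le (toFinset_subset_support he)
      (by rwa [card_toFinset_of_mem_edgeFinset (hJ he)])
  rw [← Sym2.mem_toFinset, ← Sym2.mem_toFinset, h e₁ h₁, h e₂ h₂]

lemma le_m2 {J : Finset (Sym2 (Fin k))} (hJ : J ⊆ H.edgeFinset) (hJ2 : 2 ≤ J.card) :
    ((J.card : ℝ) - 1) / ((support J).card - 2) ≤ m2 H := by
  let F : H.Subgraph :=
    { verts := support J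
      Adj := fun u v => s(u, v) ∈ J
      adj_sub := fun h => by simpa using hJ h
      edge_vert := fun {u v} h => by
        simpa [support] using ⟨s(u, v), h, Sym2.mem_mk_left u v⟩
      symm := ⟨fun u v h => by rwa [Sym2.eq_swap]⟩ }
  have hF : F.edgeSet = J := by
    ext ⟨u, v⟩
    rfl
  refine le_csSup ?_ ⟨F, ?_, ?_⟩
  · refine Set.Finite.bddAbove (Set.Finite.subset (Set.finite_range fun F : H.Subgraph =>
      ((F.edgeSet.ncard : ℝ) - 1) / ((F.verts.ncard : ℝ) - 2)) ?_)
    rintro x ⟨F, -, rfl⟩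
    exact ⟨F, rfl⟩
  · rwa [hF, Set.ncard_coe_finset]
  · rw [hF, Set.ncard_coe_finset]
    congr 2
    rw [← Set.ncard_coe_finset]

lemma one_le_pow_mul_pow {x : ℝ} (hn : 1 ≤ n)
    (hxn : (n : ℝ) ^ (-(1 / m2 H)) ≤ x) {J : Finset (Sym2 (Fin k))}
    (hJ : J ⊆ H.edgeFinset) :
    1 ≤ (n : ℝ) ^ ((support J).card - 2) * x ^ (J.card - 1) := by
  have hn1 : (1 : ℝ) ≤ n := by exact_mod_cast hn
  rcases Nat.lt_or_ge J.card 2 with h | h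
  · have : J.card - 1 = 0 := by omega
    rw [this, pow_zero, mul_one]
    exact one_le_pow₀ hn1
  have hv := two_lt_card_support hJ h
  have hm := le_m2 hJ h
  have hv' : (0 : ℝ) < (support J).card - 2 := by
    have : (2 : ℝ) < (support J).card := by exact_mod_cast hv
    linarith
  have hj : (0 : ℝ) < (J.card : ℝ) - 1 := by
    have : (2 : ℝ) ≤ J.card := by exact_mod_cast h
    linarith
  have hm0 : 0 < m2 H := lt_of_lt_of_le (by positivity) hm
  have hexp : ((J.card : ℝ) - 1) / m2 H ≤ (support J).card - 2 := by
    rw [div_le_iff₀ hv'] at hm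
    rwa [div_le_iff₀ hm0, mul_comm]
  have hcast : ((J.card - 1 : ℕ) : ℝ) = (J.card : ℝ) - 1 := by
    rw [Nat.cast_sub (by omega), Nat.cast_one]
  have hcast' : (((support J).card - 2 : ℕ) : ℝ) = ((support J).card : ℝ) - 2 := by
    rw [Nat.cast_sub (by omega), Nat.cast_ofNat]
  have hn0 : (0 : ℝ) < n := by linarith
  calc (1 : ℝ) = (n : ℝ) ^ (((J.card : ℝ) - 1) / m2 H) *
        ((n : ℝ) ^ (-(1 / m2 H))) ^ (J.card - 1) := by
        rw [← Real.rpow_natCast, ← Real.rpow_mul hn0.le, ← Real.rpow_add hn0, hcast,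
          show ((J.card : ℝ) - 1) / m2 H + -(1 / m2 H) * ((J.card : ℝ) - 1) = 0 by ring,
          Real.rpow_zero]
    _ ≤ (n : ℝ) ^ ((support J).card - 2) * x ^ (J.card - 1) := by
        refine mul_le_mul ?_ (pow_le_pow_left₀ (by positivity) hxn _) (by positivity)
          (by positivity)
        rw [← Real.rpow_natCast, hcast']
        exact Real.rpow_le_rpow_of_exponent_le hn1 hexp

lemma card_embedding_filter_le (V : Finset (Fin k)) (R : Finset (Fin n)) :
    (Finset.univ.filter fun f : Fin k ↪ Fin n => ∀ v ∈ V, f v ∈ R).card ≤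
      R.card ^ V.card * n ^ (k - V.card) := by
  calc _ ≤ (Fintype.piFinset fun v => if v ∈ V then R else Finset.univ).card := by
        refine Finset.card_le_card_of_injOn (fun f => ⇑f) ?_ fun f _ g _ h =>
          DFunLike.coe_injective h
        intro f hf
        simp only [Finset.coe_filter, Finset.mem_univ, true_and, Set.mem_ofPred_eq] at hf
        simp only [Finset.mem_coe, Fintype.mem_piFinset]
        intro v
        split_ifs with hv
        exacts [hf v hv, Finset.mem_univ _]
    _ = _ := by
        rw [Fintype.card_piFinset]
        simp_rw [apply_ite Finset.card]
        rw [Finset.prod_ite, Finset.prod_const, Finset.prod_const, Finset.card_univ,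
          Fintype.card_fin, Finset.filter_mem_eq_inter, Finset.univ_inter,
          Finset.filter_notMem_eq_sdiff, ← Finset.compl_eq_univ_sdiff, Finset.card_compl,
          Fintype.card_fin]

/-- The contribution of two overlapping edge sets to the second moment in the random set of
density `x`. -/
def overlapWeight (x : ℝ) (A B : Finset (Edge n)) : ℝ :=
  if (A ∩ B).Nonempty then (x ^ ((A ∩ B).card - 1))⁻¹ else 0

lemma overlapWeight_nonneg {x : ℝ} (hx : 0 ≤ x) (A B : Finset (Edge n)) :
    0 ≤ overlapWeight x A B := by
  rw [overlapWeight]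
  split_ifs <;> positivity

lemma sum_overlapWeight_copyEdges_le {x : ℝ} (hx : 0 < x) (hn : 1 ≤ n)
    (hxn : (n : ℝ) ^ (-(1 / m2 H)) ≤ x) (g : Fin k ↪ Fin n) :
    (∑ f : Fin k ↪ Fin n, overlapWeight x (copyEdges H f) (copyEdges H g)) * (n : ℝ) ^ 2 ≤
      2 ^ H.edgeFinset.card * ((k : ℝ) ^ k * (n : ℝ) ^ k) := by
  set I : (Fin k ↪ Fin n) → Finset (Sym2 (Fin k)) := fun f =>
    H.edgeFinset.filter fun e => Sym2.map f e ∈ Sym2.map g '' H.edgeSet with hI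
  set w : Finset (Sym2 (Fin k)) → ℝ :=
    fun J => if J.Nonempty then (x ^ (J.card - 1))⁻¹ else 0 with hw
  have hterm : ∀ f, overlapWeight x (copyEdges H f) (copyEdges H g) = w (I f) := by
    intro f
    simp only [overlapWeight, hw, hI, ← Finset.card_pos, card_copyEdges_inter]
  have hmem : ∀ f ∈ (Finset.univ : Finset (Fin k ↪ Fin n)), I f ∈ H.edgeFinset.powerset :=
    fun f _ => Finset.mem_powerset.2 (Finset.filter_subset _ _)
  simp_rw [hterm]
  rw [← Finset.sum_fiberwise_of_maps_to hmem, Finset.sum_mul]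
  refine (Finset.sum_le_card_nsmul _ _ ((k : ℝ) ^ k * (n : ℝ) ^ k) fun J hJ => ?_).trans_eq
    (by rw [Finset.card_powerset, nsmul_eq_mul]; push_cast; rfl)
  rw [Finset.mem_powerset] at hJ
  rw [Finset.sum_congr rfl fun f hf => by rw [(Finset.mem_filter.1 hf).2], Finset.sum_const,
    nsmul_eq_mul]
  by_cases hJ0 : J.Nonempty
  swap
  · simp only [hw, if_neg hJ0, mul_zero, zero_mul]
    positivity
  simp only [hw, if_pos hJ0]
  have hv2 := two_le_card_support hJ hJ0
  have hvk : (support J).card ≤ k := by simpa using Finset.card_le_univ (support J)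
  have hcard : (Finset.univ.filter fun f => I f = J).card ≤
      k ^ (support J).card * n ^ (k - (support J).card) := by
    refine le_trans (Finset.card_le_card ?_)
      ((card_embedding_filter_le (support J) (Finset.univ.map g)).trans_eq (by simp))
    intro f hf
    simp only [Finset.mem_filter, Finset.mem_univ, true_and] at hf ⊢
    intro v hv
    obtain ⟨e, he, hve⟩ := (Finset.mem_filter.1 hv).2
    rw [← hf] at he
    obtain ⟨e', -, he'⟩ := (Finset.mem_filter.1 he).2
    have : f v ∈ Sym2.map g e' := by
      rw [he']
      exact Sym2.mem_map.2 ⟨v, hve, rfl⟩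
    obtain ⟨u, -, hu⟩ := Sym2.mem_map.1 this
    simpa using ⟨u, hu⟩
  have hcard' : ((Finset.univ.filter fun f => I f = J).card : ℝ) ≤
      (k : ℝ) ^ k * (n : ℝ) ^ (k - (support J).card) := by
    have hk : 1 ≤ k := by omega
    exact_mod_cast hcard.trans (Nat.mul_le_mul_right _ (Nat.pow_le_pow_right hk hvk))
  have hone := one_le_pow_mul_pow hn hxn hJ
  have hxj : 0 < x ^ (J.card - 1) := by positivity
  rw [mul_right_comm, ← div_eq_mul_inv, div_le_iff₀ hxj]
  calc _ ≤ (k : ℝ) ^ k * (n : ℝ) ^ (k - (support J).card) * (n : ℝ) ^ 2 *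
        ((n : ℝ) ^ ((support J).card - 2) * x ^ (J.card - 1)) := by
        refine le_trans ?_ (le_mul_of_one_le_right (by positivity) hone)
        exact mul_le_mul_of_nonneg_right hcard' (by positivity)
    _ = (k : ℝ) ^ k * ((n : ℝ) ^ (k - (support J).card) * (n : ℝ) ^ 2 *
        (n : ℝ) ^ ((support J).card - 2)) * x ^ (J.card - 1) := by ring
    _ = _ := by
        rw [← pow_add, ← pow_add,
          show k - (support J).card + 2 + ((support J).card - 2) = k by omega]

lemma pow_le_two_pow_mul_card_embedding (hn : 2 * k ≤ n) :
    (n : ℝ) ^ k ≤ 2 ^ k * (Fintype.card (Fin k ↪ Fin n) : ℝ) := by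
  rw [Fintype.card_embedding_eq, Fintype.card_fin, Fintype.card_fin]
  have h := (Nat.pow_le_pow_left (show n ≤ 2 * (n + 1 - k) by omega) k).trans_eq
    (Nat.mul_pow _ _ _)
  exact_mod_cast h.trans (Nat.mul_le_mul_left _ (Nat.pow_sub_le_descFactorial n k))

variable (H)

lemma exists_sum_overlapWeight_le : ∃ C : ℝ, 0 < C ∧ ∀ n : ℕ, 1 ≤ n → 2 * k ≤ n →
    ∀ x : ℝ, 0 < x → (n : ℝ) ^ (-(1 / m2 H)) ≤ x →
      (∑ A ∈ copySets H n, ∑ B ∈ copySets H n, overlapWeight x A B) * (n : ℝ) ^ 2 ≤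
        C * ((copySets H n).card : ℝ) ^ 2 := by
  have hk : (0 : ℝ) < (k : ℝ) ^ k := by
    rcases Nat.eq_zero_or_pos k with rfl | h
    · simp
    · positivity
  refine ⟨2 ^ H.edgeFinset.card * ((k : ℝ) ^ k * 2 ^ k), by positivity,
    fun n hn hkn x hx hxn => ?_⟩
  have : Nonempty (Fin k ↪ Fin n) := ⟨Fin.castLEEmb (by omega)⟩
  obtain ⟨z, hz, hsum⟩ := exists_mul_sum_copySets (n := n) H
  set D : ℝ := (Fintype.card (Fin k ↪ Fin n) : ℝ) with hD
  have hM : z * (copySets H n).card = D := by simpa [hD] using hsum fun _ => 1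
  refine le_of_mul_le_mul_left ?_ (pow_pos hz 2)
  calc z ^ 2 * ((∑ A ∈ copySets H n, ∑ B ∈ copySets H n, overlapWeight x A B) * (n : ℝ) ^ 2)
      = ∑ g : Fin k ↪ Fin n,
          (∑ f : Fin k ↪ Fin n, overlapWeight x (copyEdges H f) (copyEdges H g)) *
            (n : ℝ) ^ 2 := by
        rw [← Finset.sum_mul, ← mul_assoc]
        congr 1
        rw [← hsum fun B => ∑ f : Fin k ↪ Fin n, overlapWeight x (copyEdges H f) B,
          Finset.sum_comm, sq, mul_assoc, Finset.mul_sum (a := z)]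
        congr 1
        exact Finset.sum_congr rfl fun B _ => hsum fun A => overlapWeight x A B
    _ ≤ ∑ _g : Fin k ↪ Fin n, 2 ^ H.edgeFinset.card * ((k : ℝ) ^ k * (n : ℝ) ^ k) :=
        Finset.sum_le_sum fun g _ => sum_overlapWeight_copyEdges_le hx hn hxn g
    _ = 2 ^ H.edgeFinset.card * (k : ℝ) ^ k * D * (n : ℝ) ^ k := by
        rw [Finset.sum_const, nsmul_eq_mul, Finset.card_univ, hD]
        ring
    _ ≤ 2 ^ H.edgeFinset.card * (k : ℝ) ^ k * D * (2 ^ k * D) := by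
        refine mul_le_mul_of_nonneg_left (pow_le_two_pow_mul_card_embedding hkn) ?_
        positivity
    _ = _ := by
        rw [← hM]
        ring

end Copies

section Energy

variable {k n : ℕ} (H : SimpleGraph (Fin k)) {μ : EGraph n → ℝ} {p : ℝ} {W : Finset (Edge n)}

/-- The pairs `(A, B)` over which the energy of `W` sums. -/
def energyPairs (W : Finset (Edge n)) : Finset (Finset (Edge n) × Finset (Edge n)) :=
  Finset.univ.filter fun x =>
    (x.1 ∈ copySets H n ∧ Disjoint x.1 W) ∧ x.2 ⊆ x.1 ∧ 2 ≤ x.2.card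

lemma sum_energyPairs (W : Finset (Edge n)) (f : Finset (Edge n) → Finset (Edge n) → ℝ) :
    ∑ x ∈ energyPairs H W, f x.1 x.2 =
      ∑ A ∈ (copySets H n).filter (fun A => Disjoint A W),
        ∑ B ∈ A.powerset.filter (fun B => 2 ≤ B.card), f A B :=
  Finset.sum_finset_product' _ _ _ fun x => by simp [energyPairs]

lemma energy_eq_sum_energyPairs : energy H μ p W =
    ∑ x ∈ energyPairs H W, ∑ b ∈ x.2,
      (((H.edgeSet.ncard.choose x.2.card * x.2.card : ℕ) : ℝ))⁻¹ *
        (∑ G, μ G * DW μ W x.2 b G ^ 2) / p ^ (2 * x.2.card) := by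
  rw [sum_energyPairs H W fun _ B => ∑ b ∈ B,
    (((H.edgeSet.ncard.choose B.card * B.card : ℕ) : ℝ))⁻¹ *
        (∑ G, μ G * DW μ W B b G ^ 2) / p ^ (2 * B.card), energy]
  simp_rw [Finset.mul_sum]
  rw [Finset.sum_comm]
  refine Finset.sum_congr rfl fun A _ => ?_
  rw [Finset.sum_comm]
  refine Finset.sum_congr rfl fun B _ => ?_
  rw [Finset.sum_comm]
  refine Finset.sum_congr rfl fun b _ => ?_
  rw [Finset.sum_div]
  refine Finset.sum_congr rfl fun G _ => ?_
  rw [Nat.cast_mul, div_eq_mul_inv, div_eq_mul_inv, mul_inv]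
  ring

lemma sum_energyPairs_fst_le (W : Finset (Edge n)) {f : Finset (Edge n) → ℝ}
    (hf : ∀ A, 0 ≤ f A) :
    ∑ x ∈ energyPairs H W, f x.1 ≤ 2 ^ H.edgeFinset.card * ∑ A ∈ copySets H n, f A := by
  rw [sum_energyPairs H W fun A _ => f A, Finset.mul_sum]
  refine (Finset.sum_le_sum_of_subset_of_nonneg (Finset.filter_subset _ _) fun A _ _ =>
    Finset.sum_nonneg fun _ _ => hf A).trans (Finset.sum_le_sum fun A hA => ?_)
  obtain ⟨g, rfl⟩ := (mem_copySets_iff H).1 hA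
  rw [Finset.sum_const, nsmul_eq_mul]
  refine mul_le_mul_of_nonneg_right ?_ (hf _)
  have := Finset.card_filter_le (copyEdges H g).powerset fun B => 2 ≤ B.card
  rw [Finset.card_powerset, card_copyEdges] at this
  exact_mod_cast this

lemma sum_inter_le_overlapWeight {x : ℝ} (hx : 0 < x) (hx1 : x ≤ 1)
    {A A' B B' : Finset (Edge n)} (hB : B ⊆ A) (hB' : B' ⊆ A') :
    ∑ _b ∈ B ∩ B', (x ^ ((B ∩ B').card - 1))⁻¹ ≤ A.card * overlapWeight x A A' := by
  rw [Finset.sum_const, nsmul_eq_mul]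
  rcases (B ∩ B').eq_empty_or_nonempty with h | h
  · rw [h, Finset.card_empty, Nat.cast_zero, zero_mul]
    exact mul_nonneg (Nat.cast_nonneg _) (overlapWeight_nonneg hx.le _ _)
  have hsub := Finset.inter_subset_inter hB hB'
  have hcard := Finset.card_le_card hsub
  rw [overlapWeight, if_pos (h.mono hsub)]
  refine mul_le_mul ?_ ?_ (by positivity) (Nat.cast_nonneg _)
  · exact_mod_cast hcard.trans (Finset.card_le_card Finset.inter_subset_left)
  · exact inv_anti₀ (by positivity) (pow_le_pow_of_le_one hx.le hx1 (by omega))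

lemma exists_sum_energyPairs_le : ∃ C : ℝ, 0 < C ∧ ∀ n : ℕ, 1 ≤ n → 2 * k ≤ n →
    ∀ x : ℝ, 0 < x → x ≤ 1 → (n : ℝ) ^ (-(1 / m2 H)) ≤ x → ∀ W : Finset (Edge n),
      (∑ y ∈ energyPairs H W, ∑ z ∈ energyPairs H W, ∑ _b ∈ y.2 ∩ z.2,
        (x ^ ((y.2 ∩ z.2).card - 1))⁻¹) * (n : ℝ) ^ 2 ≤ C * ((copySets H n).card : ℝ) ^ 2 := by
  obtain ⟨C, hC, hsum⟩ := exists_sum_overlapWeight_le H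
  set r := H.edgeFinset.card with hr
  refine ⟨2 ^ r * 2 ^ r * (r + 1) * C, by positivity, fun n hn hkn x hx hx1 hxn W => ?_⟩
  have hpair : ∀ y ∈ energyPairs H W, ∀ z ∈ energyPairs H W,
      ∑ _b ∈ y.2 ∩ z.2, (x ^ ((y.2 ∩ z.2).card - 1))⁻¹ ≤
        (r + 1) * overlapWeight x y.1 z.1 := by
    intro y hy z hz
    simp only [energyPairs, Finset.mem_filter, Finset.mem_univ, true_and] at hy hz
    obtain ⟨g, hg⟩ := (mem_copySets_iff H).1 hy.1.1
    refine (sum_inter_le_overlapWeight hx hx1 hy.2.1 hz.2.1).trans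
      (mul_le_mul_of_nonneg_right ?_ (overlapWeight_nonneg hx.le _ _))
    rw [← hg, card_copyEdges]
    linarith
  have hQ : ∑ y ∈ energyPairs H W, ∑ z ∈ energyPairs H W, ∑ _b ∈ y.2 ∩ z.2,
      (x ^ ((y.2 ∩ z.2).card - 1))⁻¹ ≤
      2 ^ r * 2 ^ r * (r + 1) * ∑ A ∈ copySets H n, ∑ B ∈ copySets H n,
        overlapWeight x A B := by
    calc _ ≤ ∑ y ∈ energyPairs H W, (r + 1) * ∑ z ∈ energyPairs H W,
          overlapWeight x y.1 z.1 := by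
          simp_rw [Finset.mul_sum]
          exact Finset.sum_le_sum fun y hy => Finset.sum_le_sum fun z hz => hpair y hy z hz
      _ ≤ ∑ y ∈ energyPairs H W, (r + 1) * (2 ^ r * ∑ B ∈ copySets H n,
          overlapWeight x y.1 B) := by
          refine Finset.sum_le_sum fun y _ => mul_le_mul_of_nonneg_left ?_ (by positivity)
          exact sum_energyPairs_fst_le H W fun B => overlapWeight_nonneg hx.le _ _
      _ ≤ 2 ^ r * ∑ A ∈ copySets H n, (r + 1) * (2 ^ r * ∑ B ∈ copySets H n,
          overlapWeight x A B) := by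
          refine sum_energyPairs_fst_le H W (f := fun A => (r + 1) * (2 ^ r *
            ∑ B ∈ copySets H n, overlapWeight x A B)) fun A => ?_
          have := Finset.sum_nonneg fun B (_ : B ∈ copySets H n) =>
            overlapWeight_nonneg hx.le A B
          positivity
      _ = _ := by
          rw [← Finset.mul_sum, ← Finset.mul_sum]
          ring
  calc _ ≤ 2 ^ r * 2 ^ r * (r + 1) * (∑ A ∈ copySets H n, ∑ B ∈ copySets H n,
        overlapWeight x A B) * (n : ℝ) ^ 2 := mul_le_mul_of_nonneg_right hQ (by positivity)
    _ ≤ _ := by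
        rw [mul_assoc, mul_assoc _ C]
        exact mul_le_mul_of_nonneg_left (hsum n hn hkn x hx hxn) (by positivity)

lemma sum_sq_condExpW_singleton_le (hμ : ∀ G, 0 ≤ μ G) (hμ1 : ∑ G, μ G = 1)
    (hY : ∀ A : Finset (Edge n), Disjoint A W →
      ∀ G, 0 < μ G → condExpW μ W (YA A) G ≤ p ^ A.card) {b : Edge n} (hb : b ∉ W) :
    ∑ G, μ G * condExpW μ W (YA {b}) G ^ 2 ≤ p ^ 2 := by
  rw [← one_mul (p ^ 2), ← hμ1, Finset.sum_mul]
  refine Finset.sum_le_sum fun G _ => ?_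
  rcases (hμ G).eq_or_lt with h | h
  · simp [← h]
  have := hY {b} (by simpa using hb) G h
  rw [Finset.card_singleton, pow_one] at this
  exact mul_le_mul_of_nonneg_left
    (pow_le_pow_left₀ (condExpW_nonneg hμ (YA_nonneg _) G) this 2) h.le

/-- A small set `W` such that no enlargement of `W` raises the expected squares of the
conditional edge probabilities by much. -/
lemma exists_increment_le (hμ : ∀ G, 0 ≤ μ G) (hμ1 : ∑ G, μ G = 1) (hp : 0 < p)
    (hY : ∀ W A : Finset (Edge n), Disjoint A W →
      ∀ G, 0 < μ G → condExpW μ W (YA A) G ≤ p ^ A.card) {α : ℝ} (hα : 0 < α) :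
    ∃ W : Finset (Edge n), (W.card : ℝ) ≤ α * Fintype.card (Edge n) ∧
      ∀ S, ∑ b, (if b ∉ W ∪ S then ∑ G, μ G * condExpW μ (W ∪ S) (YA {b}) G ^ 2 -
        ∑ G, μ G * condExpW μ W (YA {b}) G ^ 2 else 0) ≤ (1 + α⁻¹) * p ^ 2 * S.card := by
  set Q : Finset (Edge n) → Edge n → ℝ :=
    fun W b => ∑ G, μ G * condExpW μ W (YA {b}) G ^ 2 with hQ
  have hQ0 : ∀ W b, 0 ≤ Q W b := fun W b =>
    Finset.sum_nonneg fun G _ => mul_nonneg (hμ G) (sq_nonneg _)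
  have hQp : ∀ W b, b ∉ W → Q W b ≤ p ^ 2 := fun W b hb =>
    sum_sq_condExpW_singleton_le hμ hμ1 (hY W) hb
  set Φ : Finset (Edge n) → ℝ := fun W => ∑ b, if b ∉ W then Q W b else 0 with hΦ
  obtain ⟨W, -, hW⟩ := Finset.exists_max_image Finset.univ
    (fun W => Φ W - α⁻¹ * p ^ 2 * W.card) Finset.univ_nonempty
  refine ⟨W, ?_, fun S => ?_⟩
  · have h1 := hW ∅ (Finset.mem_univ _)
    have h0 : 0 ≤ Φ ∅ := Finset.sum_nonneg fun b _ => by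
      split_ifs
      exacts [le_rfl, hQ0 _ _]
    have h2 : Φ W ≤ Fintype.card (Edge n) * p ^ 2 := by
      rw [← nsmul_eq_mul, ← Finset.card_univ]
      refine Finset.sum_le_card_nsmul _ _ _ fun b _ => ?_
      split_ifs with hb
      exacts [by positivity, hQp W b hb]
    rw [Finset.card_empty, Nat.cast_zero, mul_zero, sub_zero] at h1
    have h3 : p ^ 2 * (α⁻¹ * W.card) ≤ p ^ 2 * Fintype.card (Edge n) := by linarith
    have h4 := le_of_mul_le_mul_left h3 (by positivity)
    rwa [inv_mul_le_iff₀ hα] at h4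
  · have h1 := hW (W ∪ S) (Finset.mem_univ _)
    have h2 : ((W ∪ S).card : ℝ) ≤ W.card + S.card := by
      exact_mod_cast Finset.card_union_le W S
    have h3 : ∑ b, (if b ∉ W ∪ S then Q (W ∪ S) b - Q W b else 0) ≤
        Φ (W ∪ S) - Φ W + S.card * p ^ 2 := by
      have h4 : (S.card : ℝ) * p ^ 2 = ∑ b, if b ∈ S then p ^ 2 else 0 := by
        rw [Finset.sum_ite_mem, Finset.univ_inter, Finset.sum_const, nsmul_eq_mul]
      rw [h4, hΦ, ← Finset.sum_sub_distrib, ← Finset.sum_add_distrib]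
      refine Finset.sum_le_sum fun b _ => ?_
      have := hQp W b
      have hp2 : 0 ≤ p ^ 2 := by positivity
      by_cases hbW : b ∈ W <;> by_cases hbS : b ∈ S <;> simp_all
    have h5 : 0 ≤ α⁻¹ * p ^ 2 := by positivity
    have h6 := mul_le_mul_of_nonneg_left h2 h5
    linarith

end Energy

/-- Entropy increment, KS Lemma 18. -/
theorem statement4 {k : ℕ} (H : SimpleGraph (Fin k))
    (hH : ∃ F : H.Subgraph, 2 ≤ F.edgeSet.ncard)
    (α β : ℝ) (hα : 0 < α) (hβ : 0 < β) :
    ∃ (L : ℝ) (n₀ : ℕ), 0 < L ∧ ∀ n : ℕ, n₀ ≤ n → ∀ p : ℝ, p ∈ Set.Ioo (0:ℝ) 1 →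
      L * (n : ℝ) ^ (-(1 / m2 H)) ≤ p →
      ∀ μ : EGraph n → ℝ, (∀ G, 0 ≤ μ G) → (∑ G : EGraph n, μ G) = 1 →
        (∀ (W A : Finset (Edge n)), Disjoint A W →
          ∀ G0 : EGraph n, 0 < μ G0 → condExpW μ W (YA A) G0 ≤ p ^ A.card) →
        ∃ W : Finset (Edge n), (W.card : ℝ) ≤ α * (n.choose 2 : ℝ) ∧
          energy H μ p W ≤ β * NHKn H n := by
  obtain ⟨C, hC, hQ⟩ := exists_sum_energyPairs_le H
  set K : ℝ := 1 + α⁻¹ with hKdef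
  have hK0 : 0 < K := by positivity
  set ε : ℝ := min (1 / 2) (β ^ 2 / (4 * C * K)) with hεdef
  have hε : 0 < ε := lt_min (by norm_num) (by positivity)
  have hε2 : ε ≤ 1 / 2 := min_le_left _ _
  have hεK : K * ε ≤ β ^ 2 / (4 * C) := by
    calc K * ε ≤ K * (β ^ 2 / (4 * C * K)) :=
          mul_le_mul_of_nonneg_left (min_le_right _ _) hK0.le
      _ = β ^ 2 / (4 * C) := by field_simp
  refine ⟨ε⁻¹, 2 * k + 1, by positivity, fun n hn p hp hpn μ hμ hμ1 hY => ?_⟩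
  obtain ⟨hp0, hp1⟩ := hp
  rw [inv_mul_le_iff₀ hε] at hpn
  have hN : Fintype.card (Edge n) = n.choose 2 := by
    rw [Sym2.card_subtype_not_diag, Fintype.card_fin]
  obtain ⟨W, hWc, hW⟩ := exists_increment_le hμ hμ1 hp0 hY hα
  rw [hN] at hWc
  refine ⟨W, hWc, ?_⟩
  by_contra! hlt
  set M : ℝ := ((copySets H n).card : ℝ) with hMdef
  have hM : 0 < M := by
    have f : Fin k ↪ Fin n := Fin.castLEEmb (by omega)
    exact Nat.cast_pos.2 (Finset.card_pos.2 ⟨_, (mem_copySets_iff H).2 ⟨f, rfl⟩⟩)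
  have hn0 : (0 : ℝ) < n := by
    have : 0 < n := by omega
    exact_mod_cast this
  have hEn : β * M < energy H μ p W :=
    (mul_le_mul_of_nonneg_left (card_copySets_le H) hβ.le).trans_lt hlt
  have hεp : ε * p ≤ 1 := by nlinarith
  have hQ' := hQ n (by omega) (by omega) (ε * p) (mul_pos hε hp0) hεp hpn W
  set θ : ℝ := p * (β / (2 * C)) * (n : ℝ) ^ 2 / M with hθ
  have hθ0 : 0 < θ := by positivity
  have hmain := correlation_le_of_increment_le hμ hμ1 hp0 hY hε (by linarith)
    (a := fun B => (((H.edgeSet.ncard.choose B.card * B.card : ℕ) : ℝ))⁻¹)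
    (fun B => by positivity) (fun B => Nat.cast_inv_le_one _) (P := energyPairs H W)
    (fun x hx => by
      have := (Finset.mem_filter.1 hx).2
      exact this.1.2.mono_left this.2.1) hW θ
  rw [← energy_eq_sum_energyPairs, hN] at hmain
  set Q := ∑ y ∈ energyPairs H W, ∑ z ∈ energyPairs H W, ∑ _b ∈ y.2 ∩ z.2,
    ((ε * p) ^ ((y.2 ∩ z.2).card - 1))⁻¹
  have hchoose : (n.choose 2 : ℝ) ≤ (n : ℝ) ^ 2 := by exact_mod_cast Nat.choose_le_pow n 2
  have h1 : p ^ 2 * n ^ 2 * (β ^ 2 / (2 * C)) < 2 * θ * ((1 - ε) * p * energy H μ p W) := by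
    calc p ^ 2 * n ^ 2 * (β ^ 2 / (2 * C)) = θ * p * (β * M) := by
          rw [hθ]
          field_simp
      _ < θ * p * energy H μ p W := mul_lt_mul_of_pos_left hEn (by positivity)
      _ ≤ θ * p * energy H μ p W * (2 * (1 - ε)) := by
          refine le_mul_of_one_le_right ?_ (by linarith)
          have : 0 < energy H μ p W := lt_trans (by positivity) hEn
          positivity
      _ = _ := by ring
  have h2 : θ ^ 2 * Q ≤ p ^ 2 * n ^ 2 * (β ^ 2 / (4 * C)) := by
    calc θ ^ 2 * Q = (p * (β / (2 * C)) / M) ^ 2 * n ^ 2 * (Q * (n : ℝ) ^ 2) := by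
          rw [hθ]
          ring
      _ ≤ (p * (β / (2 * C)) / M) ^ 2 * n ^ 2 * (C * M ^ 2) :=
          mul_le_mul_of_nonneg_left hQ' (by positivity)
      _ = _ := by
          field_simp
          norm_num
  have h3 : K * p ^ 2 * (ε * (n.choose 2 : ℝ)) ≤ p ^ 2 * n ^ 2 * (β ^ 2 / (4 * C)) := by
    calc K * p ^ 2 * (ε * (n.choose 2 : ℝ)) ≤ K * p ^ 2 * (ε * (n : ℝ) ^ 2) := by gcongr
      _ = p ^ 2 * n ^ 2 * (K * ε) := by ring
      _ ≤ _ := mul_le_mul_of_nonneg_left hεK (by positivity)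
  have h4 : p ^ 2 * n ^ 2 * (β ^ 2 / (2 * C)) =
      p ^ 2 * n ^ 2 * (β ^ 2 / (4 * C)) + p ^ 2 * n ^ 2 * (β ^ 2 / (4 * C)) := by
    field_simp
    norm_num
  linarith

end LowerTails
end
end

section
/- Let H be a finite graph with e(H) ≥ 1 and let η ∈ (η_H, 1). Then for every n ≥ v(H), the constant vector q* ∈ [0,1]^{E(K_n)} with q*_e = η^{1/e(H)} for all e is the unique minimizer of Φ(H,η): it satisfies E[N_H(q*)] = η·N_H(K_n) and Σ_e h(q*_e) = binom(n,2)·h(η^{1/e(H)}) = Φ(H,η), and every q ∈ [0,1]^{E(K_n)} with E[N_H(q)] ≤ η·N_H(K_n) and q ≠ q* satisfies Σ_e h(q_e) > Φ(H,η). -/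
open scoped BigOperators

attribute [local instance] Classical.propDecidable

noncomputable section

namespace LowerTails

/-! ### The tangent line inequality -/

lemma hasDerivAt_tangentGap (B v : ℝ) :
    HasDerivAt (fun u : ℝ => 1 - (1 + u) * Real.exp (-u) - B * (u - 1 + Real.exp (-u)))
      (Real.exp (-v) * (v - B * (Real.exp v - 1))) v := by
  have h1 : HasDerivAt (fun u : ℝ => Real.exp (-u)) (Real.exp (-v) * (-1)) v :=
    (hasDerivAt_neg v).exp
  have h2 : HasDerivAt (fun u : ℝ => 1 + u) 1 v := (hasDerivAt_id v).const_add 1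
  have h3 : HasDerivAt (fun u : ℝ => u - 1) 1 v := (hasDerivAt_id v).sub_const 1
  have h := ((h2.mul h1).const_sub 1).sub ((h3.add h1).const_mul B)
  refine h.congr_deriv ?_
  have : Real.exp (-v) * Real.exp v = 1 := by rw [← Real.exp_add]; simp
  linear_combination B * this

lemma exists_slope_tangentGap (B : ℝ) {x y : ℝ} (hxy : x < y) :
    ∃ v ∈ Set.Ioo x y, Real.exp (-v) * (v - B * (Real.exp v - 1)) * (y - x) =
      (1 - (1 + y) * Real.exp (-y) - B * (y - 1 + Real.exp (-y))) -
      (1 - (1 + x) * Real.exp (-x) - B * (x - 1 + Real.exp (-x))) := by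
  obtain ⟨v, hv, h⟩ := exists_hasDerivAt_eq_slope
    (fun u : ℝ => 1 - (1 + u) * Real.exp (-u) - B * (u - 1 + Real.exp (-u)))
    (fun v => Real.exp (-v) * (v - B * (Real.exp v - 1))) hxy
    (fun v _ => (hasDerivAt_tangentGap B v).continuousAt.continuousWithinAt)
    (fun v _ => hasDerivAt_tangentGap B v)
  refine ⟨v, hv, ?_⟩
  rw [h, div_mul_cancel₀ _ (sub_pos.2 hxy).ne']

/-- If the tangent gap with slope parameter `B₀` vanishes at `u₀ > 0`, then for every smaller
parameter `B` the gap is positive to the left of `u₀`, except at the tangency point `0`. -/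
lemma tangentGap_pos {B B₀ u₀ v : ℝ} (hB : 0 < B) (hBB : B < B₀) (hu₀ : 0 < u₀)
    (h₀ : 1 - (1 + u₀) * Real.exp (-u₀) - B₀ * (u₀ - 1 + Real.exp (-u₀)) = 0)
    (hv : v < u₀) (hv0 : v ≠ 0) :
    0 < 1 - (1 + v) * Real.exp (-v) - B * (v - 1 + Real.exp (-v)) := by
  have hD : 0 < v - 1 + Real.exp (-v) := by
    have := Real.add_one_lt_exp (neg_ne_zero.2 hv0); linarith
  have hB1 : B₀ < 1 := by
    obtain ⟨w, hw, h⟩ := exists_slope_tangentGap B₀ hu₀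
    rw [h₀] at h
    norm_num at h
    rcases h with h | h
    · have := Real.add_one_lt_exp hw.1.ne'
      nlinarith [hw.1]
    · exact absurd h hu₀.ne'
  rcases lt_or_gt_of_ne hv0 with hneg | hpos
  · obtain ⟨w, hw, h⟩ := exists_slope_tangentGap B hneg
    norm_num at h
    have h1 := Real.add_one_lt_exp hw.2.ne
    have h2 : Real.exp w < 1 := by simpa using hw.2
    have h3 : w - B * (Real.exp w - 1) < 0 := by nlinarith
    have h4 := mul_neg_of_pos_of_neg (Real.exp_pos (-w)) h3
    nlinarith
  · suffices 0 ≤ 1 - (1 + v) * Real.exp (-v) - B₀ * (v - 1 + Real.exp (-v)) by nlinarith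
    by_contra! hlt
    obtain ⟨w₁, hw₁, h1⟩ := exists_slope_tangentGap B₀ hpos
    obtain ⟨w₂, hw₂, h2⟩ := exists_slope_tangentGap B₀ hv
    norm_num at h1
    rw [h₀] at h2
    have k1 : w₁ - B₀ * (Real.exp w₁ - 1) < 0 := by
      by_contra! hk
      have := mul_nonneg (mul_nonneg (Real.exp_pos (-w₁)).le hk) hpos.le
      linarith
    have k2 : 0 < w₂ - B₀ * (Real.exp w₂ - 1) := by
      by_contra! hk
      have := mul_nonneg (mul_nonneg (Real.exp_pos (-w₂)).le (neg_nonneg.2 hk))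
        (sub_pos.2 hv).le
      linarith
    have h12 : w₁ < w₂ := hw₁.2.trans hw₂.1
    obtain ⟨-, hconv⟩ := convexOn_exp
    have hc := hconv (Set.mem_univ 0) (Set.mem_univ w₂)
      (a := (w₂ - w₁) / w₂) (b := w₁ / w₂) (div_nonneg (by linarith) (by linarith [hw₁.1]))
      (div_nonneg hw₁.1.le (by linarith [hw₁.1]))
      (by have : w₂ ≠ 0 := by linarith [hw₁.1]
          field_simp; ring)
    have hw2 : 0 < w₂ := hw₁.1.trans h12
    have e1 : ((w₂ - w₁) / w₂) • (0:ℝ) + (w₁ / w₂) • w₂ = w₁ := by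
      simp only [smul_eq_mul]; field_simp; ring
    rw [e1, smul_eq_mul, smul_eq_mul, Real.exp_zero] at hc
    have e2 : (w₂ - w₁) / w₂ * 1 + w₁ / w₂ * Real.exp w₂
        = 1 + w₁ / w₂ * (Real.exp w₂ - 1) := by field_simp; ring
    rw [e2] at hc
    have h5 : B₀ * (w₁ / w₂ * (Real.exp w₂ - 1)) ≤ w₁ / w₂ * w₂ := by
      have : 0 < w₁ / w₂ := div_pos hw₁.1 hw2
      nlinarith
    rw [div_mul_cancel₀ _ hw2.ne'] at h5
    nlinarith

lemma hfun_sub_tangent {x c : ℝ} (hx : 0 < x) (hc : 0 < c) :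
    hfun x - (hfun c + c * Real.log c * (Real.log x - Real.log c)) =
      c * (1 - (1 + (Real.log c - Real.log x)) * Real.exp (-(Real.log c - Real.log x))
        - (-Real.log c) * ((Real.log c - Real.log x) - 1
          + Real.exp (-(Real.log c - Real.log x)))) := by
  have : Real.exp (-(Real.log c - Real.log x)) = x / c := by
    rw [neg_sub, Real.exp_sub, Real.exp_log hx, Real.exp_log hc]
  rw [this]
  unfold hfun
  field_simp
  ring

/-- For `η` above the threshold, `hfun ∘ exp` lies strictly above its tangent at
`log (η ^ (1 / e))` on the half-line starting at `log (η ^ (1 / η))`. -/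
lemma tangent_lt_hfun {e η₀ η x : ℝ} (he : 1 ≤ e) (hη₀ : η₀ ∈ Set.Ioo (0:ℝ) 1)
    (hEq : etaEq e η₀) (hη : η ∈ Set.Ioo η₀ 1) (hx : η ^ (1 / η) ≤ x)
    (hxc : x ≠ η ^ (1 / e)) :
    hfun (η ^ (1 / e)) + η ^ (1 / e) * Real.log (η ^ (1 / e)) *
      (Real.log x - Real.log (η ^ (1 / e))) < hfun x := by
  have hη0 : 0 < η := hη₀.1.trans hη.1
  have hx0 : 0 < x := (Real.rpow_pos_of_pos hη0 _).trans_le hx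
  have hc0 : 0 < η ^ (1 / e) := Real.rpow_pos_of_pos hη0 _
  have hlog : Real.log (η ^ (1 / e)) = 1 / e * Real.log η := Real.log_rpow hη0 _
  have hlog₀ : Real.log (η₀ ^ (1 / e)) = 1 / e * Real.log η₀ := Real.log_rpow hη₀.1 _
  have hlogx : 1 / η * Real.log η ≤ Real.log x := by
    rw [← Real.log_rpow hη0]
    exact Real.log_le_log (Real.rpow_pos_of_pos hη0 _) hx
  have hgap := hfun_sub_tangent (Real.rpow_pos_of_pos hη₀.1 (1 / η₀))
    (Real.rpow_pos_of_pos hη₀.1 (1 / e))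
  rw [← hEq, sub_self, eq_comm, mul_eq_zero] at hgap
  have hgap := hgap.resolve_left (Real.rpow_pos_of_pos hη₀.1 _).ne'
  have hL : Real.log η < 0 := Real.log_neg hη0 hη.2
  have hLL : Real.log η₀ < Real.log η := Real.log_lt_log hη₀.1 hη.1
  have he0 : 0 < 1 / e := by positivity
  have he1 : 1 / e ≤ 1 := by rw [div_le_one (by linarith)]; exact he
  have hi : 1 < 1 / η := by rw [lt_div_iff₀ hη0]; linarith [hη.2]
  have hii : 1 / η < 1 / η₀ := one_div_lt_one_div_of_lt hη₀.1 hη.1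
  have hη₀log : Real.log (η₀ ^ (1 / η₀)) = 1 / η₀ * Real.log η₀ := Real.log_rpow hη₀.1 _
  have key := tangentGap_pos (B := -Real.log (η ^ (1 / e)))
    (v := Real.log (η ^ (1 / e)) - Real.log x)
    (by rw [hlog]; nlinarith) (by rw [hlog, hlog₀]; nlinarith)
    (by rw [hlog₀, hη₀log]; nlinarith) hgap
    (by rw [hlog, hlog₀, hη₀log]; nlinarith)
    (fun h => hxc (Real.log_injOn_pos hx0 hc0 (sub_eq_zero.1 h).symm))
  have := hfun_sub_tangent hx0 hc0
  have := mul_pos hc0 key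
  linarith

/-! ### The variational problem for a regular hypergraph -/

lemma hfun_sub_le {x y : ℝ} (hx : 0 ≤ x) (hy : 0 < y) :
    hfun y - hfun x ≤ (y - x) * Real.log y := by
  unfold hfun
  rcases hx.eq_or_lt with rfl | hx
  · simp; linarith
  · have h := Real.log_le_sub_one_of_pos (div_pos hy hx)
    rw [Real.log_div hy.ne' hx.ne'] at h
    have := mul_le_mul_of_nonneg_left h hx.le
    have e : x * (y / x - 1) = y - x := by field_simp
    rw [e] at this
    linarith

lemma prod_perturb_le {V : Type*} (s : Finset V) {q : V → ℝ} (hq : ∀ v, q v ∈ Set.Icc (0:ℝ) 1) (e : V)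
    {θ t : ℝ} (hθ : θ ∈ Set.Icc (0:ℝ) 1) (ht : 0 ≤ t) :
    ∏ v ∈ s, ((1 - θ) * q v + if v = e then t else 0) ≤
      (1 - θ) ^ s.card * ∏ v ∈ s, q v + if e ∈ s then t else 0 := by
  have h1 : (0:ℝ) ≤ 1 - θ := sub_nonneg.2 hθ.2
  split_ifs with he
  · have hrest : ∏ v ∈ s.erase e, ((1 - θ) * q v + if v = e then t else 0) =
        ∏ v ∈ s.erase e, ((1 - θ) * q v) :=
      Finset.prod_congr rfl fun v hv => by simp [Finset.ne_of_mem_erase hv]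
    rw [← Finset.mul_prod_erase s _ he, hrest, if_pos rfl, add_mul,
      Finset.mul_prod_erase s (fun v => (1 - θ) * q v) he, Finset.prod_mul_distrib,
      Finset.prod_const]
    have : ∏ v ∈ s.erase e, ((1 - θ) * q v) ≤ 1 :=
      Finset.prod_le_one (fun v _ => mul_nonneg h1 (hq v).1)
        (fun v _ => mul_le_one₀ (by linarith [hθ.1]) (hq v).1 (hq v).2)
    have := mul_le_mul_of_nonneg_left this ht
    linarith
  · have hrest : ∏ v ∈ s, ((1 - θ) * q v + if v = e then t else 0) = ∏ v ∈ s, ((1 - θ) * q v) :=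
      Finset.prod_congr rfl fun v hv => by
        have : v ≠ e := fun h => he (h ▸ hv)
        simp [this]
    rw [hrest, Finset.prod_mul_distrib, Finset.prod_const, add_zero]

lemma sum_prod_perturb_le {V ι : Type*} [Fintype ι] {A : ι → Finset V} {d r : ℕ}
    (hd : ∀ i, (A i).card = d)
    (hr : ∀ v, (Finset.univ.filter fun i => v ∈ A i).card = r)
    {q : V → ℝ} (hq : ∀ v, q v ∈ Set.Icc (0:ℝ) 1) (e : V)
    {θ t : ℝ} (hθ : θ ∈ Set.Icc (0:ℝ) 1) (ht : 0 ≤ t) :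
    ∑ i, ∏ v ∈ A i, ((1 - θ) * q v + if v = e then t else 0) ≤
      (1 - θ) ^ d * ∑ i, ∏ v ∈ A i, q v + r * t := by
  refine (Finset.sum_le_sum fun i _ => prod_perturb_le (A i) hq e hθ ht).trans ?_
  rw [Finset.sum_add_distrib, ← Finset.sum_filter, Finset.sum_const, hr e, nsmul_eq_mul,
    Finset.mul_sum]
  simp [hd]

section Hypergraph

variable {V ι : Type*} [Fintype V] [Fintype ι] {A : ι → Finset V} {d r : ℕ}

lemma sum_sum_mem_of_regular (hr : ∀ v, (Finset.univ.filter fun i => v ∈ A i).card = r)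
    (w : V → ℝ) : ∑ i, ∑ v ∈ A i, w v = r * ∑ v, w v := by
  rw [Finset.sum_comm' (t' := Finset.univ) (s' := fun v => Finset.univ.filter fun i => v ∈ A i)
    (by simp)]
  simp [hr, Finset.mul_sum]

lemma card_mul_eq_of_regular (hd : ∀ i, (A i).card = d)
    (hr : ∀ v, (Finset.univ.filter fun i => v ∈ A i).card = r) :
    (Fintype.card ι : ℝ) * d = r * Fintype.card V := by
  have := sum_sum_mem_of_regular hr (fun _ => (1:ℝ))
  simpa [hd] using this

lemma exists_lt_one_of_sum_prod_lt {q : V → ℝ} (hq : ∀ v, q v ∈ Set.Icc (0:ℝ) 1)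
    (h : ∑ i, ∏ v ∈ A i, q v < Fintype.card ι) : ∃ e, q e < 1 := by
  by_contra! hc
  have : ∀ v, q v = 1 := fun v => le_antisymm (hq v).2 (hc v)
  simp [this] at h

/-- A minimizer of the entropy saturates the constraint. -/
lemma sum_prod_eq_of_minimizer (hd : ∀ i, (A i).card = d)
    (hr : ∀ v, (Finset.univ.filter fun i => v ∈ A i).card = r) [Nonempty ι]
    {η : ℝ} (hη : η ∈ Set.Ioo (0:ℝ) 1) {q : V → ℝ} (hq : ∀ v, q v ∈ Set.Icc (0:ℝ) 1)
    (hF : ∑ i, ∏ v ∈ A i, q v ≤ η * Fintype.card ι)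
    (hmin : ∀ y : V → ℝ, (∀ v, y v ∈ Set.Icc (0:ℝ) 1) →
      ∑ i, ∏ v ∈ A i, y v ≤ η * Fintype.card ι → ∑ v, hfun (q v) ≤ ∑ v, hfun (y v)) :
    ∑ i, ∏ v ∈ A i, q v = η * Fintype.card ι := by
  refine hF.eq_of_not_lt fun hlt => ?_
  have hN : (0:ℝ) < Fintype.card ι := by exact_mod_cast Fintype.card_pos
  obtain ⟨e, he⟩ := exists_lt_one_of_sum_prod_lt hq (hF.trans_lt (by nlinarith [hη.2]))
  have ev1 : ∀ᶠ t : ℝ in nhdsWithin (0:ℝ) (Set.Ioi 0), q e + t < 1 := by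
    refine Filter.Eventually.filter_mono nhdsWithin_le_nhds ?_
    exact ContinuousAt.eventually_lt (by fun_prop) (by fun_prop) (by simpa using he)
  have ev2 : ∀ᶠ t : ℝ in nhdsWithin (0:ℝ) (Set.Ioi 0), ∑ i, ∏ v ∈ A i, q v + r * t < η * Fintype.card ι := by
    refine Filter.Eventually.filter_mono nhdsWithin_le_nhds ?_
    exact ContinuousAt.eventually_lt (by fun_prop) (by fun_prop) (by simpa using hlt)
  obtain ⟨t, h1, h2, ht : 0 < t⟩ := (ev1.and (ev2.and self_mem_nhdsWithin)).exists
  have hP := sum_prod_perturb_le hd hr hq e (θ := 0) (by simp) ht.le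
  simp only [sub_zero, one_pow, one_mul] at hP
  have hlt' := hmin (fun v => q v + if v = e then t else 0) (fun v => by
    by_cases hv : v = e
    · subst hv; simp only [if_true]; exact ⟨by linarith [(hq v).1], h1.le⟩
    · simpa [hv] using hq v) (hP.trans h2.le)
  refine hlt'.not_gt (Finset.sum_lt_sum (fun v _ => ?_) ⟨e, Finset.mem_univ e, ?_⟩)
  · by_cases hv : v = e
    · subst hv
      have := hfun_sub_le (hq v).1 (y := q v + t) (by linarith [(hq v).1])
      have := Real.log_nonpos (x := q v + t) (by linarith [(hq v).1]) h1.le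
      simp only [if_true]
      nlinarith
    · simp [hv]
  · have := hfun_sub_le (hq e).1 (y := q e + t) (by linarith [(hq e).1])
    have := Real.log_neg (x := q e + t) (by linarith [(hq e).1]) h1
    simp only [if_true]
    nlinarith

/-- Once the constraint is saturated, the average of `-q log q` is less than `-log η`. -/
lemma sum_neg_mul_log_lt (hd : ∀ i, (A i).card = d) (hd0 : 0 < d)
    (hr : ∀ v, (Finset.univ.filter fun i => v ∈ A i).card = r) [Nonempty ι]
    {η : ℝ} (hη : η ∈ Set.Ioo (0:ℝ) 1) {q : V → ℝ} (hq : ∀ v, q v ∈ Set.Icc (0:ℝ) 1)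
    (hF : ∑ i, ∏ v ∈ A i, q v = η * Fintype.card ι) :
    ∑ v, -(q v * Real.log (q v)) < Fintype.card V * -Real.log η := by
  have hN : (0:ℝ) < Fintype.card ι := by exact_mod_cast Fintype.card_pos
  have hcard := card_mul_eq_of_regular hd hr
  have hdR : (0:ℝ) < d := by exact_mod_cast hd0
  have hr0 : (0:ℝ) < r := by
    refine lt_of_le_of_ne (by positivity) fun h => ?_
    rw [← h, zero_mul] at hcard
    exact (mul_pos hN hdR).ne' hcard
  obtain ⟨e, he⟩ := exists_lt_one_of_sum_prod_lt hq (by rw [hF]; nlinarith [hη.2])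
  have hS : Fintype.card V * η ≤ ∑ v, q v := by
    have h1 : ∑ i, d * ∏ v ∈ A i, q v ≤ ∑ i, ∑ v ∈ A i, q v := by
      refine Finset.sum_le_sum fun i _ => ?_
      rw [← hd i, ← nsmul_eq_mul]
      refine Finset.card_nsmul_le_sum _ _ _ fun v hv => ?_
      rw [← Finset.mul_prod_erase _ _ hv]
      exact mul_le_of_le_one_right (hq v).1
        (Finset.prod_le_one (fun u _ => (hq u).1) fun u _ => (hq u).2)
    rw [← Finset.mul_sum, hF, sum_sum_mem_of_regular hr] at h1
    have : r * (Fintype.card V * η) ≤ r * ∑ v, q v := by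
      calc _ = d * (η * Fintype.card ι) := by linear_combination -η * hcard
        _ ≤ _ := h1
    exact le_of_mul_le_mul_left this hr0
  have hS' : ∑ v, q v < Fintype.card V := by
    have := Finset.sum_lt_sum (fun v _ => (hq v).2) ⟨e, Finset.mem_univ e, he⟩
    simpa using this
  have hlog := Real.log_neg hη.1 hη.2
  have hpt : ∀ v, -(q v * Real.log (q v)) ≤ q v * -Real.log η + η - q v := fun v => by
    have := hfun_sub_le (hq v).1 hη.1
    unfold hfun at this
    linarith
  have := Finset.sum_le_sum fun v (_ : v ∈ Finset.univ) => hpt v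
  rw [Finset.sum_sub_distrib, Finset.sum_add_distrib, ← Finset.sum_mul] at this
  simp only [Finset.sum_const, Finset.card_univ, nsmul_eq_mul] at this
  nlinarith

lemma hfun_perturb_sub_le {x θ t β : ℝ} (hx : 0 ≤ x) (hθ : θ ∈ Set.Ico (0:ℝ) 1) (ht : 0 < t)
    (hβ : x + t ≤ β) :
    hfun ((1 - θ) * x + t) - hfun x ≤
      -θ * (x * Real.log (1 - θ) + x * Real.log x) + t * Real.log β := by
  have h1 : (0:ℝ) < 1 - θ := sub_pos.2 hθ.2
  have hy : 0 < (1 - θ) * x + t := by positivity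
  have hlog : Real.log ((1 - θ) * x + t) ≤ Real.log β :=
    Real.log_le_log hy (by nlinarith [mul_nonneg hθ.1 hx])
  have h2 := hfun_sub_le hx hy
  have h3 : x * Real.log (1 - θ) + x * Real.log x ≤ x * Real.log ((1 - θ) * x + t) := by
    rcases hx.eq_or_lt with rfl | hx
    · simp
    · rw [← mul_add, ← Real.log_mul h1.ne' hx.ne']
      exact mul_le_mul_of_nonneg_left
        (Real.log_le_log (by positivity) (by linarith)) hx.le
  nlinarith [mul_le_mul_of_nonneg_left hlog ht.le, mul_le_mul_of_nonneg_left h3 hθ.1]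

lemma hfun_scale_sub_le {x θ : ℝ} (hx : 0 ≤ x) (hθ : θ ∈ Set.Ico (0:ℝ) 1) :
    hfun ((1 - θ) * x) - hfun x ≤ -θ * (x * Real.log (1 - θ) + x * Real.log x) := by
  have h1 : (0:ℝ) < 1 - θ := sub_pos.2 hθ.2
  rcases hx.eq_or_lt with rfl | hx
  · simp
  · refine (hfun_sub_le hx.le (mul_pos h1 hx)).trans_eq ?_
    rw [Real.log_mul h1.ne' hx.ne']
    ring

/-- Every coordinate of a minimizer of the entropy is at least `η ^ (1 / η)`. -/
lemma rpow_le_of_minimizer (hd : ∀ i, (A i).card = d) (hd0 : 0 < d)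
    (hr : ∀ v, (Finset.univ.filter fun i => v ∈ A i).card = r) [Nonempty ι]
    {η : ℝ} (hη : η ∈ Set.Ioo (0:ℝ) 1) {q : V → ℝ} (hq : ∀ v, q v ∈ Set.Icc (0:ℝ) 1)
    (hF : ∑ i, ∏ v ∈ A i, q v = η * Fintype.card ι)
    (hmin : ∀ y : V → ℝ, (∀ v, y v ∈ Set.Icc (0:ℝ) 1) →
      ∑ i, ∏ v ∈ A i, y v ≤ η * Fintype.card ι → ∑ v, hfun (q v) ≤ ∑ v, hfun (y v)) (e : V) :
    η ^ (1 / η) ≤ q e := by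
  by_contra! hlt
  set β := η ^ (1 / η) with hβ
  have hlogβ : Real.log β = 1 / η * Real.log η := Real.log_rpow hη.1 _
  have hβ1 : β < 1 := Real.rpow_lt_one hη.1.le hη.2 (one_div_pos.2 hη.1)
  have hN : (0:ℝ) < Fintype.card ι := by exact_mod_cast Fintype.card_pos
  have hM : (0:ℝ) < Fintype.card V := by exact_mod_cast Fintype.card_pos_iff.2 ⟨e⟩
  have hdR : (0:ℝ) < d := by exact_mod_cast hd0
  have hcard := card_mul_eq_of_regular hd hr
  have hQ := sum_neg_mul_log_lt hd hd0 hr hη hq hF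
  have hQ0 : 0 ≤ ∑ v, -(q v * Real.log (q v)) := Finset.sum_nonneg fun v _ => by
    nlinarith [(hq v).1, Real.log_nonpos (hq v).1 (hq v).2]
  set Q := ∑ v, -(q v * Real.log (q v)) with hQdef
  set M : ℝ := (Fintype.card V : ℝ)
  set N : ℝ := (Fintype.card ι : ℝ)
  set S := ∑ v, q v with hS
  have hℓ : 0 < -Real.log η := neg_pos.2 (Real.log_neg hη.1 hη.2)
  set ℓ := -Real.log η with hℓdef
  obtain ⟨s, hs0, hs1, hs2⟩ : ∃ s : ℝ, 0 < s ∧ 1 < s * η * M ∧ s * Q < ℓ / η := by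
    have hQM : 0 < Q + M * ℓ := by positivity
    have hη0 := hη.1
    refine ⟨2 * ℓ / (η * (Q + M * ℓ)), by positivity, ?_, ?_⟩
    · rw [div_mul_eq_mul_div, div_mul_eq_mul_div, lt_div_iff₀ (by positivity)]
      nlinarith
    · rw [div_mul_eq_mul_div, div_lt_div_iff₀ (by positivity) hη0]
      have : 0 < η * ℓ := by positivity
      nlinarith
  have ev1 : ∀ᶠ t : ℝ in nhdsWithin (0:ℝ) (Set.Ioi 0), q e + t < β := by
    refine Filter.Eventually.filter_mono nhdsWithin_le_nhds ?_
    exact ContinuousAt.eventually_lt (by fun_prop) (by fun_prop) (by simpa using hlt)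
  have ev2 : ∀ᶠ t : ℝ in nhdsWithin (0:ℝ) (Set.Ioi 0), s * t < 1 := by
    refine Filter.Eventually.filter_mono nhdsWithin_le_nhds ?_
    exact ContinuousAt.eventually_lt (by fun_prop) (by fun_prop) (by simp)
  have ev3 : ∀ᶠ t : ℝ in nhdsWithin (0:ℝ) (Set.Ioi 0), 1 + d * (s * t) < s * η * M := by
    refine Filter.Eventually.filter_mono nhdsWithin_le_nhds ?_
    exact ContinuousAt.eventually_lt (by fun_prop) (by fun_prop) (by simpa using hs1)
  have ev4 : ∀ᶠ t : ℝ in nhdsWithin (0:ℝ) (Set.Ioi 0), s * (Q - S * Real.log (1 - s * t)) < ℓ / η := by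
    refine Filter.Eventually.filter_mono nhdsWithin_le_nhds ?_
    refine ContinuousAt.eventually_lt ?_ (by fun_prop) (by simpa using hs2)
    have : ContinuousAt (fun t : ℝ => Real.log (1 - s * t)) 0 :=
      ContinuousAt.log (by fun_prop) (by simp)
    fun_prop
  obtain ⟨t, h1, h2, h3, h4, ht : 0 < t⟩ :=
    (ev1.and (ev2.and (ev3.and (ev4.and self_mem_nhdsWithin)))).exists
  set θ := s * t with hθdef
  have hθ0 : 0 < θ := by positivity
  have hθ : θ ∈ Set.Ico (0:ℝ) 1 := ⟨hθ0.le, h2⟩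
  have hP := sum_prod_perturb_le hd hr hq e (Set.Ico_subset_Icc_self hθ) ht.le
  have hfeas : (1 - θ) ^ d * (η * N) + r * t ≤ η * N := by
    have hb : (1 - θ) ^ d * (1 + d * θ) ≤ 1 := by
      have hb1 : 1 + d * θ ≤ (1 + θ) ^ d := one_add_mul_le_pow (by linarith) d
      calc (1 - θ) ^ d * (1 + d * θ) ≤ (1 - θ) ^ d * (1 + θ) ^ d := by
            have : 0 ≤ (1 - θ) ^ d := pow_nonneg (by linarith) d
            gcongr
        _ = (1 - θ ^ 2) ^ d := by rw [← mul_pow]; ring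
        _ ≤ 1 := pow_le_one₀ (by nlinarith) (by nlinarith)
    have hK : 0 < 1 + d * θ := by positivity
    have hη0 := hη.1
    have key : r * t * (1 + d * θ) ≤ η * N * (d * θ) := by
      have : r * t * (1 + d * θ) ≤ r * t * (s * η * M) := by gcongr
      refine this.trans_eq ?_
      rw [hθdef]
      linear_combination -(t * s * η) * hcard
    have hηN : 0 < η * N := by positivity
    refine le_of_mul_le_mul_right (a := 1 + d * θ) ?_ hK
    nlinarith [mul_le_mul_of_nonneg_left hb hηN.le]
  rw [hF] at hP
  have hge := hmin _ (fun v => ?_) (hP.trans hfeas)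
  · have hpt : ∀ v, hfun ((1 - θ) * q v + if v = e then t else 0) - hfun (q v) ≤
        -θ * (q v * Real.log (1 - θ) + q v * Real.log (q v)) +
          if v = e then t * Real.log β else 0 := fun v => by
      by_cases hv : v = e
      · subst hv
        simpa using hfun_perturb_sub_le (hq v).1 hθ ht h1.le
      · simpa [hv] using hfun_scale_sub_le (hq v).1 hθ
    have hsum := Finset.sum_le_sum fun v (_ : v ∈ Finset.univ) => hpt v
    rw [Finset.sum_sub_distrib, Finset.sum_add_distrib, ← Finset.mul_sum,
      Finset.sum_add_distrib, ← Finset.sum_mul, Finset.sum_ite_eq' Finset.univ e,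
      if_pos (Finset.mem_univ e), hlogβ] at hsum
    rw [Finset.sum_neg_distrib] at hQdef
    have hQ' : ∑ v, q v * Real.log (q v) = -Q := by linarith
    rw [hQ', ← hS] at hsum
    have h5 := mul_lt_mul_of_pos_right h4 ht
    have h6 : 1 / η * Real.log η = -(ℓ / η) := by rw [hℓdef]; ring
    rw [h6] at hsum
    have h7 : -θ * (S * Real.log (1 - θ) + -Q) = s * (Q - S * Real.log (1 - θ)) * t := by
      rw [hθdef]; ring
    linarith
  · have h8 : (1 - θ) * q v ≤ q v := by nlinarith [(hq v).1]
    have h9 : 0 ≤ (1 - θ) * q v := mul_nonneg (by linarith) (hq v).1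
    by_cases hv : v = e
    · subst hv
      simp only [if_true]
      constructor <;> linarith
    · simp only [hv, if_false, add_zero]
      exact ⟨h9, h8.trans (hq v).2⟩

lemma sum_log_le_of_sum_prod_le (hd : ∀ i, (A i).card = d) (hd0 : 0 < d)
    (hr : ∀ v, (Finset.univ.filter fun i => v ∈ A i).card = r) [Nonempty ι]
    {η : ℝ} (hη : 0 < η) {q : V → ℝ} (hq : ∀ v, 0 < q v)
    (hF : ∑ i, ∏ v ∈ A i, q v ≤ η * Fintype.card ι) :
    ∑ v, Real.log (q v) ≤ Fintype.card V * Real.log (η ^ (1 / (d : ℝ))) := by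
  have hN : (0:ℝ) < Fintype.card ι := by exact_mod_cast Fintype.card_pos
  have hcard := card_mul_eq_of_regular hd hr
  have hdR : (0:ℝ) < d := by exact_mod_cast hd0
  have hr0 : (0:ℝ) < r := by
    refine lt_of_le_of_ne (by positivity) fun h => ?_
    rw [← h, zero_mul] at hcard
    exact (mul_pos hN hdR).ne' hcard
  have hpt : ∀ i, ∑ v ∈ A i, Real.log (q v) ≤ (∏ v ∈ A i, q v) / η - 1 + Real.log η := by
    intro i
    have hpos : 0 < ∏ v ∈ A i, q v := Finset.prod_pos fun v _ => hq v
    rw [← Real.log_prod fun v _ => (hq v).ne']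
    have := Real.log_le_sub_one_of_pos (div_pos hpos hη)
    rw [Real.log_div hpos.ne' hη.ne'] at this
    linarith
  have hsum := Finset.sum_le_sum fun i (_ : i ∈ Finset.univ) => hpt i
  rw [sum_sum_mem_of_regular hr, Finset.sum_add_distrib, Finset.sum_sub_distrib,
    ← Finset.sum_div] at hsum
  simp only [Finset.sum_const, Finset.card_univ, nsmul_eq_mul, mul_one] at hsum
  have : (∑ i, ∏ v ∈ A i, q v) / η ≤ Fintype.card ι := by
    rw [div_le_iff₀ hη]; linarith
  rw [Real.log_rpow hη]
  refine le_of_mul_le_mul_left (a := (r:ℝ)) ?_ hr0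
  have e : r * (Fintype.card V * (1 / (d:ℝ) * Real.log η)) = Fintype.card ι * Real.log η := by
    field_simp
    linear_combination -Real.log η * hcard
  rw [e]
  linarith

/-- In a regular uniform hypergraph, if `hfun ∘ exp` lies above its tangent at
`log (η ^ (1 / d))` on the half-line starting at `log (η ^ (1 / η))`, then the constant vector is
the unique minimizer of the entropy. -/
theorem entropy_lt_of_ne_const (hd : ∀ i, (A i).card = d) (hd0 : 0 < d)
    (hr : ∀ v, (Finset.univ.filter fun i => v ∈ A i).card = r) [Nonempty ι]
    {η : ℝ} (hη : η ∈ Set.Ioo (0:ℝ) 1)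
    (htan : ∀ x, η ^ (1 / η) ≤ x → x ≠ η ^ (1 / (d : ℝ)) →
      hfun (η ^ (1 / (d : ℝ))) + η ^ (1 / (d : ℝ)) * Real.log (η ^ (1 / (d : ℝ))) *
        (Real.log x - Real.log (η ^ (1 / (d : ℝ)))) < hfun x)
    {q : V → ℝ} (hq : ∀ v, q v ∈ Set.Icc (0:ℝ) 1)
    (hF : ∑ i, ∏ v ∈ A i, q v ≤ η * Fintype.card ι) (hne : q ≠ fun _ => η ^ (1 / (d : ℝ))) :
    ∑ _v : V, hfun (η ^ (1 / (d : ℝ))) < ∑ v, hfun (q v) := by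
  set c := η ^ (1 / (d : ℝ)) with hc
  have hdR : (0:ℝ) < d := by exact_mod_cast hd0
  have hc0 : 0 < c := Real.rpow_pos_of_pos hη.1 _
  have hc1 : c < 1 := Real.rpow_lt_one hη.1.le hη.2 (one_div_pos.2 hdR)
  have hclog := Real.log_neg hc0 hc1
  have hcd : c ^ d = η := by
    rw [hc, one_div, Real.rpow_inv_natCast_pow hη.1.le hd0.ne']
  have huniq : ∀ p : V → ℝ, (∀ v, p v ∈ Set.Icc (0:ℝ) 1) →
      ∑ i, ∏ v ∈ A i, p v ≤ η * Fintype.card ι →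
      (∀ y : V → ℝ, (∀ v, y v ∈ Set.Icc (0:ℝ) 1) →
        ∑ i, ∏ v ∈ A i, y v ≤ η * Fintype.card ι → ∑ v, hfun (p v) ≤ ∑ v, hfun (y v)) →
      p = fun _ => c := by
    intro p hp hpF hmin
    by_contra hpc
    obtain ⟨e, he⟩ := Function.ne_iff.1 hpc
    have hEq := sum_prod_eq_of_minimizer hd hr hη hp hpF hmin
    have hlow := rpow_le_of_minimizer hd hd0 hr hη hp hEq hmin
    have hpos : ∀ v, 0 < p v := fun v => (Real.rpow_pos_of_pos hη.1 _).trans_le (hlow v)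
    have hlog := sum_log_le_of_sum_prod_le hd hd0 hr hη.1 hpos hpF
    rw [← hc] at hlog
    have hlt : ∑ v, (hfun c + c * Real.log c * (Real.log (p v) - Real.log c)) <
        ∑ v, hfun (p v) := by
      refine Finset.sum_lt_sum (fun v _ => ?_) ⟨e, Finset.mem_univ e, htan _ (hlow e) he⟩
      by_cases hv : p v = c
      · simp [hv]
      · exact (htan _ (hlow v) hv).le
    have hle := hmin (fun _ => c) (fun _ => ⟨hc0.le, hc1.le⟩) (by simp [hd, hcd, mul_comm])
    rw [Finset.sum_add_distrib, ← Finset.mul_sum, Finset.sum_sub_distrib] at hlt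
    simp only [Finset.sum_const, Finset.card_univ, nsmul_eq_mul] at hlt hle
    have : 0 ≤ c * Real.log c *
        (∑ v, Real.log (p v) - Fintype.card V * Real.log c) :=
      mul_nonneg_of_nonpos_of_nonpos (by nlinarith) (by linarith)
    linarith
  have hcompact : IsCompact ((Set.univ.pi fun _ : V => Set.Icc (0:ℝ) 1) ∩
      {p | ∑ i, ∏ v ∈ A i, p v ≤ η * Fintype.card ι}) :=
    (isCompact_univ_pi fun _ => isCompact_Icc).inter_right
      (isClosed_le (by fun_prop) (by fun_prop))
  have hcont : Continuous fun p : V → ℝ => ∑ v, hfun (p v) := by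
    have h : Continuous hfun := (Real.continuous_mul_log.sub continuous_id).add continuous_const
    exact continuous_finsetSum _ fun v _ => h.comp (continuous_apply v)
  obtain ⟨p, ⟨hp, hpF⟩, hmin⟩ := hcompact.exists_isMinOn ⟨q, fun v _ => hq v, hF⟩
    hcont.continuousOn
  have hpc := huniq p (fun v => hp v trivial) hpF fun y hy hyF => hmin ⟨fun v _ => hy v, hyF⟩
  have hle : ∀ y : V → ℝ, (∀ v, y v ∈ Set.Icc (0:ℝ) 1) →
      ∑ i, ∏ v ∈ A i, y v ≤ η * Fintype.card ι → ∑ _v : V, hfun c ≤ ∑ v, hfun (y v) :=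
    fun y hy hyF => by
      have := hmin (a := y) ⟨fun v _ => hy v, hyF⟩
      simpa [hpc] using this
  refine (hle q hq hF).lt_of_ne fun heq => hne (huniq q hq hF fun y hy hyF => ?_)
  exact heq ▸ hle y hy hyF

end Hypergraph

/-! ### Copies of `H` in `K_n` as a regular hypergraph -/

/-- The copies of `H` in `K_n`. -/
abbrev CopyIn {k : ℕ} (H : SimpleGraph (Fin k)) (n : ℕ) :=
  {K : (⊤ : SimpleGraph (Fin n)).Subgraph // Nonempty (H ≃g K.coe)}

/-- The edges of a copy of `H` in `K_n`. -/
def CopyIn.edges {k n : ℕ} {H : SimpleGraph (Fin k)} (K : CopyIn H n) : Finset (Edge n) :=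
  Finset.univ.filter fun e => (e : Sym2 (Fin n)) ∈ K.1.edgeSet

/-- The preimage of a copy of `H` under a permutation of the vertices. -/
def CopyIn.relabel {k n : ℕ} {H : SimpleGraph (Fin k)} (σ : Equiv.Perm (Fin n))
    (K : CopyIn H n) : CopyIn H n :=
  ⟨{ verts := σ ⁻¹' K.1.verts
     Adj := fun u v => K.1.Adj (σ u) (σ v)
     adj_sub := fun h => by
       have := (K.1.adj_sub h).ne
       exact fun huv => this (congrArg σ huv)
     edge_vert := fun h => K.1.edge_vert h
     symm := ⟨fun _ _ h => K.1.symm.symm _ _ h⟩ },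
   K.2.map fun φ => φ.trans
    { toEquiv := (σ.subtypeEquiv fun _ => Iff.rfl).symm
      map_rel_iff' := fun {a b} => by
        simp [SimpleGraph.Subgraph.coe_adj, Equiv.subtypeEquiv] }⟩

variable {k n : ℕ} {H : SimpleGraph (Fin k)}

lemma CopyIn.relabel_relabel (σ τ : Equiv.Perm (Fin n)) (h : ∀ x, σ (τ x) = x) (K : CopyIn H n) :
    (K.relabel σ).relabel τ = K := by
  apply Subtype.ext
  apply SimpleGraph.Subgraph.ext
  · ext x; simp [CopyIn.relabel, h]
  · funext x y; simp [CopyIn.relabel, h]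

lemma exists_perm_map_eq (e e' : Edge n) :
    ∃ σ : Equiv.Perm (Fin n), Sym2.map σ (e : Sym2 (Fin n)) = e' := by
  obtain ⟨e, he⟩ := e
  obtain ⟨e', he'⟩ := e'
  induction e with | _ a b
  induction e' with | _ c d
  simp only [Sym2.mk_isDiag_iff] at he he'
  refine ⟨Equiv.swap (Equiv.swap a c b) d * Equiv.swap a c, ?_⟩
  have h : c ≠ Equiv.swap a c b := fun h => he <| by
    have := congrArg (Equiv.swap a c) h
    simpa using this
  simp [Equiv.swap_apply_of_ne_of_ne h he']

lemma CopyIn.mem_edges_relabel (σ : Equiv.Perm (Fin n)) {e e' : Edge n}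
    (h : Sym2.map σ (e : Sym2 (Fin n)) = e') (K : CopyIn H n) :
    e ∈ (K.relabel σ).edges ↔ e' ∈ K.edges := by
  simp only [CopyIn.edges, Finset.mem_filter, Finset.mem_univ, true_and, ← h]
  obtain ⟨e, he⟩ := e
  induction e with | _ a b
  simp [CopyIn.relabel]

lemma CopyIn.card_filter_mem_edges (e e' : Edge n) :
    (Finset.univ.filter fun K : CopyIn H n => e ∈ K.edges).card =
      (Finset.univ.filter fun K : CopyIn H n => e' ∈ K.edges).card := by
  obtain ⟨σ, h⟩ := exists_perm_map_eq e e'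
  refine Finset.card_bij' (fun K _ => K.relabel σ.symm) (fun K _ => K.relabel σ) ?_ ?_ ?_ ?_
  · intro K hK
    simp only [Finset.mem_filter, Finset.mem_univ, true_and] at hK ⊢
    rwa [← CopyIn.mem_edges_relabel σ h, CopyIn.relabel_relabel _ _ (by simp)]
  · intro K hK
    simp only [Finset.mem_filter, Finset.mem_univ, true_and] at hK ⊢
    rwa [CopyIn.mem_edges_relabel σ h]
  · intro K _; exact CopyIn.relabel_relabel _ _ (by simp) K
  · intro K _; exact CopyIn.relabel_relabel _ _ (by simp) K

lemma CopyIn.card_edges (K : CopyIn H n) : K.edges.card = H.edgeSet.ncard := by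
  obtain ⟨φ⟩ := K.2
  have h1 : K.1.edgeSet.ncard = H.edgeSet.ncard := by
    rw [← SimpleGraph.Subgraph.image_coe_edgeSet_coe,
      Set.ncard_image_of_injective _ (Sym2.map.injective Subtype.val_injective)]
    exact (Nat.card_congr φ.mapEdgeSet).symm
  rw [← h1, ← Finset.card_map (Function.Embedding.subtype _), ← Set.ncard_coe_finset]
  congr 1
  ext e
  simp only [CopyIn.edges, Finset.coe_map, Finset.coe_filter, Set.mem_image, Finset.mem_univ,
    true_and, Set.mem_ofPred_eq, Function.Embedding.subtype_apply, Subtype.exists, exists_and_left,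
    exists_prop, exists_eq_right_right, and_iff_left_iff_imp]
  exact fun he => SimpleGraph.not_isDiag_of_mem_edgeSet _ (K.1.edgeSet_subset he)

lemma CopyIn.nonempty (h : k ≤ n) : Nonempty (CopyIn H n) := by
  let f : SimpleGraph.Copy H (⊤ : SimpleGraph (Fin n)) :=
    ⟨⟨Fin.castLE h, fun hab => (Fin.castLE_injective h).ne hab.ne⟩, Fin.castLE_injective h⟩
  exact ⟨⟨f.toSubgraph, ⟨f.isoToSubgraph⟩⟩⟩

lemma NHKn_eq_card : NHKn H n = Fintype.card (CopyIn H n) := by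
  rw [NHKn, countCopies, ← Nat.card_coe_set_eq, ← Nat.card_eq_fintype_card]
  rfl

lemma NH_eq_sum (G : EGraph n) :
    NH H G = ∑ K : CopyIn H n, if ∀ e ∈ K.edges, G e = true then (1:ℝ) else 0 := by
  rw [NH, countCopies, Finset.sum_boole, Nat.cast_inj, ← Set.ncard_coe_finset]
  have hadj : ∀ u v : Fin n, (toSG G).Adj u v ↔ ∃ h : ¬ s(u, v).IsDiag, G ⟨s(u, v), h⟩ = true :=
    fun u v => by
      simp only [toSG, SimpleGraph.fromEdgeSet_adj, Set.mem_ofPred_eq, and_iff_left_iff_imp]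
      rintro ⟨h, -⟩
      simpa using h
  refine Set.ncard_congr
    (fun L hL => ⟨{ verts := L.verts
                    Adj := L.Adj
                    adj_sub := fun h => (L.adj_sub h).ne
                    edge_vert := L.edge_vert
                    symm := L.symm }, hL⟩) ?_ ?_ ?_
  · intro L hL
    simp only [CopyIn.edges, Finset.coe_filter, Finset.mem_univ, true_and, Set.mem_ofPred_eq,
      Finset.mem_filter]
    rintro ⟨e, he⟩ heL
    induction e with | _ a b
    obtain ⟨_, h⟩ := (hadj a b).1 (L.adj_sub heL)
    exact h
  · intro L L' hL hL' h
    exact SimpleGraph.Subgraph.ext (congrArg (fun K : CopyIn H n => K.1.verts) h)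
      (congrArg (fun K : CopyIn H n => K.1.Adj) h)
  · rintro ⟨K, hK⟩ hKG
    simp only [CopyIn.edges, Finset.coe_filter, Finset.mem_univ, true_and, Set.mem_ofPred_eq,
      Finset.mem_filter] at hKG
    refine ⟨{ verts := K.verts
              Adj := K.Adj
              adj_sub := fun {u v} h => (hadj u v).2
                ⟨by simpa using (K.adj_sub h).ne, hKG _ h⟩
              edge_vert := K.edge_vert
              symm := K.symm }, hK, rfl⟩

lemma sum_wt_mul_indicator (q : Edge n → ℝ) (s : Finset (Edge n)) :
    ∑ G : EGraph n, wt q G * (if ∀ e ∈ s, G e = true then (1:ℝ) else 0) = ∏ e ∈ s, q e := by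
  have h : ∀ G : EGraph n, wt q G * (if ∀ e ∈ s, G e = true then (1:ℝ) else 0) =
      ∏ e, if G e then q e else if e ∈ s then 0 else 1 - q e := by
    intro G
    split_ifs with hG
    · rw [mul_one, wt]
      refine Finset.prod_congr rfl fun e _ => ?_
      by_cases he : e ∈ s
      · simp [hG e he]
      · simp [he]
    · push Not at hG
      obtain ⟨e, he, hGe⟩ := hG
      rw [mul_zero, eq_comm]
      exact Finset.prod_eq_zero (Finset.mem_univ e) (by simp [hGe, he])
  rw [Finset.sum_congr rfl fun G _ => h G,
    ← Fintype.prod_sum fun e (b : Bool) => if b then q e else if e ∈ s then 0 else 1 - q e]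
  rw [← Finset.prod_subset (Finset.subset_univ s)]
  · exact Finset.prod_congr rfl fun e he => by simp [he]
  · intro e _ he
    simp [he]

lemma expNH_eq_sum_prod (q : Edge n → ℝ) :
    expNH H q = ∑ K : CopyIn H n, ∏ e ∈ K.edges, q e := by
  simp only [expNH, NH_eq_sum, Finset.mul_sum]
  rw [Finset.sum_comm]
  exact Finset.sum_congr rfl fun K _ => sum_wt_mul_indicator q K.edges

/-- Zhao: for `η > η_H` the constant vector `η^{1/e(H)}` is the unique
minimizer of `Φ(H, η)`. -/
theorem statement6 {k : ℕ} (H : SimpleGraph (Fin k)) (hH : H.edgeSet.Nonempty)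
    (ηstar η : ℝ) (hηstar : ηstar ∈ Set.Ioo (0:ℝ) 1) (hEq : etaEq (eH H) ηstar)
    (hη : η ∈ Set.Ioo ηstar 1) (n : ℕ) (hn : k ≤ n) :
    expNH H (fun _ : Edge n => η ^ (1 / eH H)) = η * NHKn H n ∧
    (∑ _e : Edge n, hfun (η ^ (1 / eH H))) = (n.choose 2 : ℝ) * hfun (η ^ (1 / eH H)) ∧
    (∑ _e : Edge n, hfun (η ^ (1 / eH H))) = Phi H n η ∧
    ∀ q : Edge n → ℝ, (∀ e, q e ∈ Set.Icc (0:ℝ) 1) → expNH H q ≤ η * NHKn H n →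
      q ≠ (fun _ => η ^ (1 / eH H)) → Phi H n η < ∑ e : Edge n, hfun (q e) := by
  have hη' : η ∈ Set.Ioo (0:ℝ) 1 := ⟨hηstar.1.trans hη.1, hη.2⟩
  have hd0 : 0 < H.edgeSet.ncard := (Set.ncard_pos (Set.toFinite _)).2 hH
  have hd1 : 1 ≤ eH H := by unfold eH; exact_mod_cast hd0
  have hc : η ^ (1 / eH H) ∈ Set.Icc (0:ℝ) 1 :=
    ⟨Real.rpow_nonneg hη'.1.le _, Real.rpow_le_one hη'.1.le hη'.2.le (by positivity)⟩
  have hcd : (η ^ (1 / eH H)) ^ H.edgeSet.ncard = η := by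
    rw [eH, one_div, Real.rpow_inv_natCast_pow hη'.1.le hd0.ne']
  have hne : Nonempty (CopyIn H n) := CopyIn.nonempty hn
  have hfirst : expNH H (fun _ : Edge n => η ^ (1 / eH H)) = η * NHKn H n := by
    rw [expNH_eq_sum_prod, NHKn_eq_card]
    simp only [Finset.prod_const, CopyIn.card_edges, hcd, Finset.sum_const, Finset.card_univ,
      nsmul_eq_mul, mul_comm]
  obtain ⟨r, hr⟩ : ∃ r, ∀ e : Edge n,
      (Finset.univ.filter fun K : CopyIn H n => e ∈ K.edges).card = r := by
    rcases isEmpty_or_nonempty (Edge n) with h | ⟨⟨e⟩⟩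
    · exact ⟨0, fun e => h.elim e⟩
    · exact ⟨_, fun e' => CopyIn.card_filter_mem_edges e' e⟩
  have hlt : ∀ q : Edge n → ℝ, (∀ e, q e ∈ Set.Icc (0:ℝ) 1) → expNH H q ≤ η * NHKn H n →
      q ≠ (fun _ => η ^ (1 / eH H)) →
      ∑ _e : Edge n, hfun (η ^ (1 / eH H)) < ∑ e : Edge n, hfun (q e) := by
    intro q hq hF hqc
    rw [expNH_eq_sum_prod, NHKn_eq_card] at hF
    exact entropy_lt_of_ne_const (A := fun K : CopyIn H n => K.edges) CopyIn.card_edges hd0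
      (fun e => by convert hr e) hη' (fun x hx hxc => tangent_lt_hfun hd1 hηstar hEq hη hx hxc) hq hF hqc
  have hPhi : ∑ _e : Edge n, hfun (η ^ (1 / eH H)) = Phi H n η := by
    symm
    apply IsLeast.csInf_eq
    refine ⟨⟨_, fun _ => hc, hfirst.le, rfl⟩, ?_⟩
    rintro x ⟨q, hq, hF, rfl⟩
    by_cases hqc : q = fun _ => η ^ (1 / eH H)
    · rw [hqc]
    · exact (hlt q hq hF hqc).le
  refine ⟨hfirst, ?_, hPhi, fun q hq hF hqc => hPhi ▸ hlt q hq hF hqc⟩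
  rw [Finset.sum_const, Finset.card_univ, nsmul_eq_mul, Sym2.card_subtype_not_diag,
    Fintype.card_fin]

end LowerTails
end
end
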